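/- (Global weighted estimate.) Suppose (A,W) ∈ T(r,C₀). Then there exist δ > 0, μ₀ > 1 and C > 0 such that for all μ ≥ μ₀ and all complex-valued u ∈ C_0^∞(ℝ^d), ∫_{ℝ^d} [ |u(x)|² R(x,μ)^{−4} + |(D − A)u(x)|² R(x,μ)^{−2} ] dx ≤ C ‖u‖² + C (1 + μ^{−2δ}) ‖ P_{A,W} u ‖², where |(D−A)u(x)|² = Σ_{j=1}^d |(D_{x_j} − A_j)u(x)|². -/

import Mathlib

open MeasureTheory Real Filter

noncomputable section

/-- `ℝ^d` with the Euclidean structure. -/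
abbrev Rd (d : ℕ) := EuclideanSpace ℝ (Fin d)

/-- Partial derivative `∂_{x_j}` of a complex-valued function. -/
def pdC {d : ℕ} (j : Fin d) (f : Rd d → ℂ) : Rd d → ℂ :=
  fun x => fderiv ℝ f x (EuclideanSpace.single j (1:ℝ))

/-- Partial derivative `∂_{x_j}` of a real-valued function. -/
def pdR {d : ℕ} (j : Fin d) (f : Rd d → ℝ) : Rd d → ℝ :=
  fun x => fderiv ℝ f x (EuclideanSpace.single j (1:ℝ))

/-- Iterated partial derivative in the `j`-th direction. -/
def pdIter {d : ℕ} (j : Fin d) : ℕ → (Rd d → ℝ) → (Rd d → ℝ)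
  | 0, f => f
  | n+1, f => pdR j (pdIter j n f)

/-- Multi-index partial derivative `∂^α`. -/
def pdMulti {d : ℕ} (α : Fin d → ℕ) (f : Rd d → ℝ) : Rd d → ℝ :=
  (List.finRange d).foldr (fun j g => pdIter j (α j) g) f

/-- The finite set of multi-indices `α` with `|α| = q`. -/
def mIdx (d q : ℕ) : Finset (Fin d → ℕ) := Finset.Nat.antidiagonalTuple d q

/-- The magnetic field `B_{jk} = ∂_j A_k - ∂_k A_j`. -/
def magB {d : ℕ} (A : Fin d → Rd d → ℝ) (j k : Fin d) : Rd d → ℝ :=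
  fun x => pdR j (A k) x - pdR k (A j) x

/-- The quantity `m̌_q(x)`. -/
def mq {d p : ℕ} (A : Fin d → Rd d → ℝ) (U : Fin p → Rd d → ℝ) (V : Rd d → ℝ) :
    ℕ → Rd d → ℝ
  | 0, x => ∑ ℓ, |U ℓ x|
  | q+1, x =>
      (∑ ℓ, ∑ α ∈ mIdx d (q+1), |pdMulti α (U ℓ) x|)
      + (∑ jk ∈ Finset.univ.filter (fun jk : Fin d × Fin d => jk.1 < jk.2),
          ∑ α ∈ mIdx d q, |pdMulti α (magB A jk.1 jk.2) x|)
      + ∑ α ∈ mIdx d q, |pdMulti α V x|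

/-- The quantity `m̌ʳ(x) = 1 + ∑_{q=0}^r m̌_q(x)`. -/
def mr {d p : ℕ} (A : Fin d → Rd d → ℝ) (U : Fin p → Rd d → ℝ) (V : Rd d → ℝ)
    (r : ℕ) (x : Rd d) : ℝ :=
  1 + ∑ q ∈ Finset.range (r+1), mq A U V q x

/-- The magnetic derivative `X_j u = (D_{x_j} - A_j) u`, `D_{x_j} = -i ∂_{x_j}`. -/
def Xop {d : ℕ} (A : Fin d → Rd d → ℝ) (j : Fin d) (u : Rd d → ℂ) : Rd d → ℂ :=
  fun x => -Complex.I * pdC j u x - (A j x : ℂ) * u x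

/-- The potential `W = ∑_ℓ U_ℓ² + iV`. -/
def Wfun {d p : ℕ} (U : Fin p → Rd d → ℝ) (V : Rd d → ℝ) (x : Rd d) : ℂ :=
  ((∑ ℓ, (U ℓ x)^2 : ℝ) : ℂ) + (V x : ℝ) * Complex.I

/-- The operator `P_{A,W} u = ∑_j X_j² u + W u` with `W = ∑_ℓ U_ℓ² + iV`. -/
def Pop {d p : ℕ} (A : Fin d → Rd d → ℝ) (U : Fin p → Rd d → ℝ) (V : Rd d → ℝ)
    (u : Rd d → ℂ) : Rd d → ℂ :=
  fun x => (∑ j, Xop A j (Xop A j u) x) + Wfun U V x * u x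

/-- The function `Φ(x,t)`. -/
def Phi {d p : ℕ} (A : Fin d → Rd d → ℝ) (U : Fin p → Rd d → ℝ) (V : Rd d → ℝ)
    (r : ℕ) (x : Rd d) (t : ℝ) : ℝ :=
  (∑ ℓ, ∑ q ∈ Finset.range (r+1), t^(q+1) * ∑ α ∈ mIdx d q, |pdMulti α (U ℓ) x|)
  + (∑ jk ∈ Finset.univ.filter (fun jk : Fin d × Fin d => jk.1 < jk.2),
      ∑ q ∈ Finset.range r, t^(q+2) * ∑ α ∈ mIdx d q, |pdMulti α (magB A jk.1 jk.2) x|)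
  + ∑ q ∈ Finset.range r, t^(q+2) * ∑ α ∈ mIdx d q, |pdMulti α V x|

/-- `R(x,μ) = sup { t ∈ [0,1] : Φ(x,t) ≤ μ }`. -/
def Rfun {d p : ℕ} (A : Fin d → Rd d → ℝ) (U : Fin p → Rd d → ℝ) (V : Rd d → ℝ)
    (r : ℕ) (x : Rd d) (μ : ℝ) : ℝ :=
  sSup {t : ℝ | t ∈ Set.Icc (0:ℝ) 1 ∧ Phi A U V r x t ≤ μ}

/-! ### Smooth functions and partial derivatives -/

abbrev SmR {d : ℕ} (f : Rd d → ℝ) : Prop := ContDiff ℝ (⊤ : ℕ∞) f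
abbrev SmC {d : ℕ} (f : Rd d → ℂ) : Prop := ContDiff ℝ (⊤ : ℕ∞) f

lemma SmR.pdR {d : ℕ} {f : Rd d → ℝ} (hf : SmR f) (j : Fin d) : SmR (pdR j f) := by
  unfold _root_.pdR
  exact (ContDiff.fderiv_right hf (m := (⊤ : ℕ∞)) (by norm_cast)).clm_apply contDiff_const

lemma SmC.pdC {d : ℕ} {f : Rd d → ℂ} (hf : SmC f) (j : Fin d) : SmC (pdC j f) := by
  unfold _root_.pdC
  exact (ContDiff.fderiv_right hf (m := (⊤ : ℕ∞)) (by norm_cast)).clm_apply contDiff_const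

lemma SmR.da {d : ℕ} {f : Rd d → ℝ} (hf : SmR f) (x : Rd d) : DifferentiableAt ℝ f x :=
  (hf.differentiable (by simp)) x

lemma SmC.da {d : ℕ} {f : Rd d → ℂ} (hf : SmC f) (x : Rd d) : DifferentiableAt ℝ f x :=
  (hf.differentiable (by simp)) x

lemma SmC.re {d : ℕ} {f : Rd d → ℂ} (hf : SmC f) : SmR (fun x => (f x).re) :=
  Complex.reCLM.contDiff.comp hf

lemma SmC.im {d : ℕ} {f : Rd d → ℂ} (hf : SmC f) : SmR (fun x => (f x).im) :=
  Complex.imCLM.contDiff.comp hf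

lemma SmR.ofReal {d : ℕ} {f : Rd d → ℝ} (hf : SmR f) : SmC (fun x => (f x : ℂ)) :=
  Complex.ofRealCLM.contDiff.comp hf

lemma pdR_re {d : ℕ} {f : Rd d → ℂ} (hf : SmC f) (j : Fin d) (x : Rd d) :
    pdR j (fun y => (f y).re) x = (pdC j f x).re := by
  have h := (Complex.reCLM.hasFDerivAt (x := f x)).comp x (hf.da x).hasFDerivAt
  unfold pdR pdC
  have h2 : fderiv ℝ (fun y => (f y).re) x = Complex.reCLM.comp (fderiv ℝ f x) := h.fderiv
  rw [h2]; rfl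

lemma pdR_im {d : ℕ} {f : Rd d → ℂ} (hf : SmC f) (j : Fin d) (x : Rd d) :
    pdR j (fun y => (f y).im) x = (pdC j f x).im := by
  have h := (Complex.imCLM.hasFDerivAt (x := f x)).comp x (hf.da x).hasFDerivAt
  unfold pdR pdC
  have h2 : fderiv ℝ (fun y => (f y).im) x = Complex.imCLM.comp (fderiv ℝ f x) := h.fderiv
  rw [h2]; rfl

lemma pdR_mul {d : ℕ} {f g : Rd d → ℝ} (hf : SmR f) (hg : SmR g) (j : Fin d) (x : Rd d) :
    pdR j (fun y => f y * g y) x = pdR j f x * g x + f x * pdR j g x := by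
  unfold pdR
  rw [fderiv_fun_mul (hf.da x) (hg.da x)]
  simp; ring

lemma pdR_add {d : ℕ} {f g : Rd d → ℝ} (hf : SmR f) (hg : SmR g) (j : Fin d) (x : Rd d) :
    pdR j (fun y => f y + g y) x = pdR j f x + pdR j g x := by
  unfold pdR
  rw [fderiv_fun_add (hf.da x) (hg.da x)]
  simp

lemma pdR_sub {d : ℕ} {f g : Rd d → ℝ} (hf : SmR f) (hg : SmR g) (j : Fin d) (x : Rd d) :
    pdR j (fun y => f y - g y) x = pdR j f x - pdR j g x := by
  unfold pdR
  rw [fderiv_fun_sub (hf.da x) (hg.da x)]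
  simp

lemma pdR_pow {d : ℕ} {f : Rd d → ℝ} (hf : SmR f) (n : ℕ) (j : Fin d) (x : Rd d) :
    pdR j (fun y => f y ^ n) x = n * f x ^ (n-1) * pdR j f x := by
  unfold pdR
  have := ((hf.da x).hasFDerivAt.pow n).fderiv
  have h2 : fderiv ℝ (fun y => f y ^ n) x = (n • f x ^ (n-1)) • fderiv ℝ f x := this
  rw [h2]
  simp

lemma pdR_comm {d : ℕ} {f : Rd d → ℝ} (hf : SmR f) (j k : Fin d) :
    pdR j (pdR k f) = pdR k (pdR j f) := by
  funext x
  have hd : DifferentiableAt ℝ (fderiv ℝ f) x :=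
    ((ContDiff.fderiv_right hf (m := (⊤ : ℕ∞)) (by norm_cast)).differentiable (by simp)) x
  have key : ∀ v w : Rd d, fderiv ℝ (fun y => fderiv ℝ f y v) x w
      = fderiv ℝ (fderiv ℝ f) x w v := by
    intro v w
    have := (hd.hasFDerivAt.clm_apply (hasFDerivAt_const v x)).fderiv
    rw [this]; simp
  unfold pdR
  rw [key, key]
  have hs : IsSymmSndFDerivAt ℝ f x :=
    ContDiffAt.isSymmSndFDerivAt hf.contDiffAt (by simpa using (WithTop.coe_le_coe (a := (⊤:ℕ∞)) (b := (2:ℕ∞))).2 le_top)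
  exact hs.eq _ _

lemma SmR.pdIter {d : ℕ} {f : Rd d → ℝ} (hf : SmR f) (j : Fin d) (n : ℕ) :
    SmR (pdIter j n f) := by
  induction n with
  | zero => exact hf
  | succ n ih => exact ih.pdR j

lemma pdR_pdIter {d : ℕ} {f : Rd d → ℝ} (hf : SmR f) (j k : Fin d) (n : ℕ) :
    pdIter k n (pdR j f) = pdR j (pdIter k n f) := by
  induction n with
  | zero => rfl
  | succ n ih =>
    change pdR k (pdIter k n (pdR j f)) = pdR j (pdR k (pdIter k n f))
    rw [ih, pdR_comm (hf.pdIter k n)]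

lemma smR_foldr {d : ℕ} {f : Rd d → ℝ} (hf : SmR f) (α : Fin d → ℕ) (l : List (Fin d)) :
    SmR (l.foldr (fun j g => pdIter j (α j) g) f) := by
  induction l with
  | nil => exact hf
  | cons k l ih => exact SmR.pdIter ih k _

lemma SmR.pdMulti {d : ℕ} {f : Rd d → ℝ} (hf : SmR f) (α : Fin d → ℕ) :
    SmR (pdMulti α f) := smR_foldr hf α _

lemma foldr_notMem {d : ℕ} (f : Rd d → ℝ) (α : Fin d → ℕ) (j : Fin d) (l : List (Fin d))
    (hj : j ∉ l) :
    l.foldr (fun k g => pdIter k ((α + Pi.single j 1 : Fin d → ℕ) k) g) f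
      = l.foldr (fun k g => pdIter k (α k) g) f := by
  induction l with
  | nil => rfl
  | cons k l ih =>
    simp only [List.mem_cons, not_or] at hj
    simp only [List.foldr_cons]
    rw [ih hj.2]
    have : (α + Pi.single j 1 : Fin d → ℕ) k = α k := by
      simp [Ne.symm hj.1]
    rw [this]

lemma foldr_mem {d : ℕ} {f : Rd d → ℝ} (hf : SmR f) (α : Fin d → ℕ) (j : Fin d)
    (l : List (Fin d)) (hn : l.Nodup) (hj : j ∈ l) :
    l.foldr (fun k g => pdIter k ((α + Pi.single j 1 : Fin d → ℕ) k) g) f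
      = pdR j (l.foldr (fun k g => pdIter k (α k) g) f) := by
  induction l with
  | nil => simp at hj
  | cons k l ih =>
    simp only [List.foldr_cons]
    rw [List.nodup_cons] at hn
    by_cases hk : j = k
    · subst hk
      rw [foldr_notMem f α j l hn.1]
      have : (α + Pi.single j 1 : Fin d → ℕ) j = α j + 1 := by simp
      rw [this]; rfl
    · have hjl : j ∈ l := by
        rcases List.mem_cons.1 hj with h | h
        · exact absurd h hk
        · exact h
      rw [ih hn.2 hjl]
      have : (α + Pi.single j 1 : Fin d → ℕ) k = α k := by
        simp [Ne.symm hk]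
      rw [this, pdR_pdIter (smR_foldr hf α l)]

lemma pdR_pdMulti {d : ℕ} {f : Rd d → ℝ} (hf : SmR f) (α : Fin d → ℕ) (j : Fin d) :
    pdR j (pdMulti α f) = pdMulti (α + Pi.single j 1) f :=
  (foldr_mem hf α j _ (List.nodup_finRange d) (List.mem_finRange j)).symm

lemma pdMulti_zero {d : ℕ} (f : Rd d → ℝ) : pdMulti (0 : Fin d → ℕ) f = f := by
  unfold pdMulti
  induction (List.finRange d) with
  | nil => rfl
  | cons k l ih => simp only [List.foldr_cons]; rw [ih]; rfl

/-! ### Integration -/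

/-- Continuous with compact support. -/
def CC {d : ℕ} (F : Rd d → ℝ) : Prop := Continuous F ∧ HasCompactSupport F

lemma CC.int {d : ℕ} {F : Rd d → ℝ} (h : CC F) : Integrable F :=
  h.1.integrable_of_hasCompactSupport h.2

lemma CC.add {d : ℕ} {F G : Rd d → ℝ} (h : CC F) (h' : CC G) : CC (fun x => F x + G x) :=
  ⟨h.1.add h'.1, h.2.add h'.2⟩

lemma CC.sub {d : ℕ} {F G : Rd d → ℝ} (h : CC F) (h' : CC G) : CC (fun x => F x - G x) :=
  ⟨h.1.sub h'.1, h.2.sub h'.2⟩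

lemma CC.mulL {d : ℕ} {F G : Rd d → ℝ} (h : Continuous F) (h' : CC G) : CC (fun x => F x * G x) :=
  ⟨h.mul h'.1, h'.2.mul_left⟩

lemma CC.sum {d : ℕ} {ι : Type*} (s : Finset ι) {F : ι → Rd d → ℝ} (h : ∀ i ∈ s, CC (F i)) :
    CC (fun x => ∑ i ∈ s, F i x) := by
  classical
  induction s using Finset.induction_on with
  | empty =>
    refine ⟨by simpa using continuous_const, ?_⟩
    simp only [Finset.sum_empty]
    exact (HasCompactSupport.zero : HasCompactSupport (0 : Rd d → ℝ))
  | insert a s ha ih =>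
    have : (fun x => ∑ i ∈ insert a s, F i x) = fun x => F a x + ∑ i ∈ s, F i x := by
      funext x; rw [Finset.sum_insert ha]
    rw [this]
    exact (h a (by simp)).add (ih (fun i hi => h i (by simp [hi])))

lemma hcs_pdR {d : ℕ} {f : Rd d → ℝ} (hf : HasCompactSupport f) (j : Fin d) :
    HasCompactSupport (pdR j f) := by
  unfold pdR
  exact hf.fderiv_apply (𝕜 := ℝ) _

lemma hcs_pdC {d : ℕ} {f : Rd d → ℂ} (hf : HasCompactSupport f) (j : Fin d) :
    HasCompactSupport (pdC j f) := by
  unfold pdC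
  exact hf.fderiv_apply (𝕜 := ℝ) _

lemma integral_pdR {d : ℕ} {F : Rd d → ℝ} (hF : SmR F) (hc : HasCompactSupport F) (j : Fin d) :
    ∫ x, pdR j F x = 0 := by
  have h1 : Integrable F := hF.continuous.integrable_of_hasCompactSupport hc
  have h2 : Integrable (pdR j F) :=
    (hF.pdR j).continuous.integrable_of_hasCompactSupport (hcs_pdR hc j)
  have := integral_mul_fderiv_eq_neg_fderiv_mul_of_integrable (μ := (volume : Measure (Rd d)))
    (f := fun _ : Rd d => (1:ℝ)) (g := F) (v := EuclideanSpace.single j (1:ℝ))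
    (by simp) (by simp only [one_mul]; exact h2) (by simpa using h1)
    (fun x _ => differentiableAt_const _) (fun x _ => hF.da x)
  simpa [pdR] using this

lemma SmC.Xop {d : ℕ} {A : Fin d → Rd d → ℝ} (hA : ∀ j, SmR (A j)) {u : Rd d → ℂ} (hu : SmC u)
    (j : Fin d) : SmC (Xop A j u) := by
  unfold _root_.Xop
  exact (contDiff_const.mul (hu.pdC j)).sub ((hA j).ofReal.mul hu)

lemma hcs_Xop {d : ℕ} (A : Fin d → Rd d → ℝ) {u : Rd d → ℂ} (hu : HasCompactSupport u)
    (j : Fin d) : HasCompactSupport (Xop A j u) := by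
  unfold Xop
  exact ((hcs_pdC hu j).mul_left (f := fun _ => -Complex.I)).sub
    (hu.mul_left (f := fun x => (A j x : ℂ)))

/-- real part of `a * conj b`. -/
def reP (a b : ℂ) : ℝ := a.re * b.re + a.im * b.im
/-- imaginary part of `a * conj b`. -/
def imP (a b : ℂ) : ℝ := a.im * b.re - a.re * b.im

lemma abs_reP (a b : ℂ) : |reP a b| ≤ ‖a‖ * ‖b‖ := by
  have h := Complex.abs_re_le_norm (a * (starRingEnd ℂ) b)
  rw [norm_mul, Complex.norm_conj] at h
  simpa [reP, Complex.mul_re] using h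

lemma abs_imP (a b : ℂ) : |imP a b| ≤ ‖a‖ * ‖b‖ := by
  have h := Complex.abs_im_le_norm (a * (starRingEnd ℂ) b)
  rw [norm_mul, Complex.norm_conj] at h
  have e : (a * (starRingEnd ℂ) b).im = imP a b := by simp [imP, Complex.mul_im]; ring
  rwa [e] at h

lemma reP_self (a : ℂ) : reP a a = ‖a‖^2 := by
  rw [Complex.sq_norm, Complex.normSq_apply]; rfl

lemma imP_self (a : ℂ) : imP a a = 0 := by unfold imP; ring

lemma SmR_reP {d : ℕ} {a b : Rd d → ℂ} (ha : SmC a) (hb : SmC b) :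
    SmR (fun x => reP (a x) (b x)) := (ha.re.mul hb.re).add (ha.im.mul hb.im)
lemma SmR_imP {d : ℕ} {a b : Rd d → ℂ} (ha : SmC a) (hb : SmC b) :
    SmR (fun x => imP (a x) (b x)) := (ha.im.mul hb.re).sub (ha.re.mul hb.im)

lemma hcs_reP {d : ℕ} {a b : Rd d → ℂ} (hb : HasCompactSupport b) :
    HasCompactSupport (fun x => reP (a x) (b x)) := by
  refine hb.mono ?_
  intro x hx hb0
  apply hx
  simp [reP, hb0]
lemma hcs_imP {d : ℕ} {a b : Rd d → ℂ} (hb : HasCompactSupport b) :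
    HasCompactSupport (fun x => imP (a x) (b x)) := by
  refine hb.mono ?_
  intro x hx hb0
  apply hx
  simp [imP, hb0]

lemma CC_reP {d : ℕ} {a b : Rd d → ℂ} (ha : SmC a) (hb : SmC b) (hc : HasCompactSupport b) :
    CC (fun x => reP (a x) (b x)) := ⟨(SmR_reP ha hb).continuous, hcs_reP hc⟩
lemma CC_imP {d : ℕ} {a b : Rd d → ℂ} (ha : SmC a) (hb : SmC b) (hc : HasCompactSupport b) :
    CC (fun x => imP (a x) (b x)) := ⟨(SmR_imP ha hb).continuous, hcs_imP hc⟩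

lemma CC_normsq {d : ℕ} {a : Rd d → ℂ} (ha : SmC a) (hc : HasCompactSupport a) :
    CC (fun x => ‖a x‖^2) := by
  have := CC_reP ha ha hc
  simpa only [reP_self] using this

lemma CC_normmul {d : ℕ} {a b : Rd d → ℂ} (ha : SmC a) (hb : SmC b) (hc : HasCompactSupport b) :
    CC (fun x => ‖a x‖ * ‖b x‖) :=
  CC.mulL ha.continuous.norm ⟨hb.continuous.norm, hc.norm⟩

lemma ibpR {d : ℕ} {A : Fin d → Rd d → ℝ} {g : Rd d → ℝ} (hg : SmR g)
    {a b : Rd d → ℂ} (ha : SmC a) (hb : SmC b) (hc : HasCompactSupport b) (j : Fin d) :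
    ∫ x, (g x * reP (Xop A j a x) (b x) - g x * reP (a x) (Xop A j b x)
      + pdR j g x * imP (a x) (b x)) = 0 := by
  rw [← integral_pdR (hg.mul (SmR_imP ha hb)) ((hcs_imP hc).mul_left (f := g)) j]
  congr 1
  funext x
  rw [pdR_mul hg (SmR_imP ha hb)]
  unfold imP
  rw [pdR_sub (ha.im.mul hb.re) (ha.re.mul hb.im), pdR_mul ha.im hb.re, pdR_mul ha.re hb.im,
    pdR_re ha, pdR_re hb, pdR_im ha, pdR_im hb]
  simp [reP, Xop]
  ring

lemma ibpI {d : ℕ} {A : Fin d → Rd d → ℝ} {g : Rd d → ℝ} (hg : SmR g)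
    {a b : Rd d → ℂ} (ha : SmC a) (hb : SmC b) (hc : HasCompactSupport b) (j : Fin d) :
    ∫ x, (g x * imP (a x) (Xop A j b x) - g x * imP (Xop A j a x) (b x)
      + pdR j g x * reP (a x) (b x)) = 0 := by
  rw [← integral_pdR (hg.mul (SmR_reP ha hb)) ((hcs_reP hc).mul_left (f := g)) j]
  congr 1
  funext x
  rw [pdR_mul hg (SmR_reP ha hb)]
  unfold reP
  rw [pdR_add (ha.re.mul hb.re) (ha.im.mul hb.im), pdR_mul ha.im hb.im, pdR_mul ha.re hb.re,
    pdR_re ha, pdR_re hb, pdR_im ha, pdR_im hb]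
  simp [imP, Xop]
  ring

lemma pdC_parts {d : ℕ} {f : Rd d → ℂ} (hf : SmC f) (j : Fin d) (x : Rd d) :
    pdC j f x = ⟨pdR j (fun y => (f y).re) x, pdR j (fun y => (f y).im) x⟩ := by
  rw [pdR_re hf, pdR_im hf]

lemma Xop_comm {d : ℕ} {A : Fin d → Rd d → ℝ} (hA : ∀ j, SmR (A j)) {u : Rd d → ℂ} (hu : SmC u)
    (j k : Fin d) (x : Rd d) :
    imP (Xop A j (Xop A k u) x) (u x) - imP (Xop A k (Xop A j u) x) (u x)
      = magB A j k x * ‖u x‖^2 := by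
  have hre : ∀ k, (fun y => (Xop A k u y).re)
      = fun y => pdR k (fun z => (u z).im) y - A k y * (u y).re := by
    intro k; funext y; rw [pdR_im hu]; simp [Xop]
  have him : ∀ k, (fun y => (Xop A k u y).im)
      = fun y => (0 - pdR k (fun z => (u z).re) y) - A k y * (u y).im := by
    intro k; funext y; rw [pdR_re hu]; simp [Xop]
  have h0 : SmR (fun _ : Rd d => (0:ℝ)) := contDiff_const
  have hz : ∀ j x, pdR j (fun _ : Rd d => (0:ℝ)) x = 0 := by intro j x; simp [pdR]
  have e : ∀ j k, imP (Xop A j (Xop A k u) x) (u x) =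
     imP (-Complex.I * pdC j (Xop A k u) x - (A j x : ℂ) * Xop A k u x) (u x) := fun _ _ => rfl
  rw [e, e, pdC_parts (hu.Xop hA k), pdC_parts (hu.Xop hA j), hre, hre, him, him]
  have r1 := fun j k => pdR_sub (hu.im.pdR k) ((hA k).mul hu.re) j x
  have r2 := fun j k => pdR_sub (h0.sub (hu.re.pdR k)) ((hA k).mul hu.im) j x
  have r3 := fun j k => pdR_sub h0 (hu.re.pdR k) j x
  have r4 := fun j k => pdR_mul (hA k) hu.re j x
  have r5 := fun j k => pdR_mul (hA k) hu.im j x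
  rw [r1, r1, r2, r2, r3, r3, r4, r4, r5, r5, pdR_comm hu.re j k, pdR_comm hu.im j k, hz, hz]
  rw [Complex.sq_norm, Complex.normSq_apply]
  have hXre := fun k => congrFun (hre k) x
  have hXim := fun k => congrFun (him k) x
  simp [imP, hXre, hXim, magB]
  ring

/-! ### Weighted energy estimates -/

lemma int_le {d : ℕ} {F G Z : Rd d → ℝ} (hF : CC F) (hG : CC G) (hZ : CC Z) (hZ0 : ∫ x, Z x = 0)
    (h : ∀ x, F x + Z x ≤ G x) : ∫ x, F x ≤ ∫ x, G x := by
  have h1 : ∫ x, (F x + Z x) ≤ ∫ x, G x :=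
    integral_mono (hF.add hZ).int hG.int h
  rw [integral_add hF.int hZ.int, hZ0, add_zero] at h1
  exact h1

lemma CC_ibpR {d : ℕ} {A : Fin d → Rd d → ℝ} (hA : ∀ j, SmR (A j)) {g : Rd d → ℝ} (hg : SmR g)
    {a b : Rd d → ℂ} (ha : SmC a) (hb : SmC b) (hc : HasCompactSupport b) (j : Fin d) :
    CC (fun x => g x * reP (Xop A j a x) (b x) - g x * reP (a x) (Xop A j b x)
      + pdR j g x * imP (a x) (b x)) :=
  ((CC.mulL hg.continuous (CC_reP (ha.Xop hA j) hb hc)).sub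
    (CC.mulL hg.continuous (CC_reP ha (hb.Xop hA j) (hcs_Xop A hc j)))).add
    (CC.mulL (hg.pdR j).continuous (CC_imP ha hb hc))

lemma CC_ibpI {d : ℕ} {A : Fin d → Rd d → ℝ} (hA : ∀ j, SmR (A j)) {g : Rd d → ℝ} (hg : SmR g)
    {a b : Rd d → ℂ} (ha : SmC a) (hb : SmC b) (hc : HasCompactSupport b) (j : Fin d) :
    CC (fun x => g x * imP (a x) (Xop A j b x) - g x * imP (Xop A j a x) (b x)
      + pdR j g x * reP (a x) (b x)) :=
  ((CC.mulL hg.continuous (CC_imP ha (hb.Xop hA j) (hcs_Xop A hc j))).sub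
    (CC.mulL hg.continuous (CC_imP (ha.Xop hA j) hb hc))).add
    (CC.mulL (hg.pdR j).continuous (CC_reP ha hb hc))

lemma SmC_Pop {d p : ℕ} {A : Fin d → Rd d → ℝ} {U : Fin p → Rd d → ℝ} {V : Rd d → ℝ}
    (hA : ∀ j, SmR (A j)) (hU : ∀ ℓ, SmR (U ℓ)) (hV : SmR V) {u : Rd d → ℂ} (hu : SmC u) :
    SmC (Pop A U V u) := by
  unfold Pop Wfun
  refine ContDiff.add (ContDiff.sum fun j _ => (hu.Xop hA j).Xop hA j) (ContDiff.mul ?_ hu)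
  refine ContDiff.add (SmR.ofReal (f := fun x => ∑ ℓ, (U ℓ x)^2)
    (ContDiff.sum fun ℓ _ => (hU ℓ).pow 2)) ?_
  exact hV.ofReal.mul contDiff_const

lemma hcs_Pop {d p : ℕ} (A : Fin d → Rd d → ℝ) (U : Fin p → Rd d → ℝ) (V : Rd d → ℝ)
    {u : Rd d → ℂ} (hc : HasCompactSupport u) : HasCompactSupport (Pop A U V u) := by
  have hs : ∀ s : Finset (Fin d), HasCompactSupport (fun x => ∑ j ∈ s, Xop A j (Xop A j u) x) := by
    classical
    intro s
    induction s using Finset.induction_on with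
    | empty =>
      simp only [Finset.sum_empty]
      exact (HasCompactSupport.zero : HasCompactSupport (0 : Rd d → ℂ))
    | insert a s ha ih =>
      have : (fun x => ∑ i ∈ insert a s, Xop A i (Xop A i u) x)
          = fun x => Xop A a (Xop A a u) x + ∑ i ∈ s, Xop A i (Xop A i u) x := by
        funext x; rw [Finset.sum_insert ha]
      rw [this]
      exact (hcs_Xop A (hcs_Xop A hc a) a).add ih
  unfold Pop
  exact (hs _).add (hc.mul_left (f := Wfun U V))

lemma reP_Pop {d p : ℕ} (A : Fin d → Rd d → ℝ) (U : Fin p → Rd d → ℝ) (V : Rd d → ℝ)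
    (u : Rd d → ℂ) (x : Rd d) : reP (Pop A U V u x) (u x)
      = (∑ j, reP (Xop A j (Xop A j u) x) (u x)) + (∑ ℓ, (U ℓ x)^2) * ‖u x‖^2 := by
  rw [Complex.sq_norm, Complex.normSq_apply]
  unfold reP Pop Wfun
  rw [Finset.sum_add_distrib, ← Finset.sum_mul, ← Finset.sum_mul]
  simp only [Complex.add_re, Complex.add_im, Complex.re_sum, Complex.im_sum, Complex.mul_re,
    Complex.mul_im, Complex.ofReal_re, Complex.ofReal_im, Complex.I_re, Complex.I_im]
  ring

lemma imP_Pop {d p : ℕ} (A : Fin d → Rd d → ℝ) (U : Fin p → Rd d → ℝ) (V : Rd d → ℝ)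
    (u : Rd d → ℂ) (x : Rd d) : imP (Pop A U V u x) (u x)
      = (∑ j, imP (Xop A j (Xop A j u) x) (u x)) + V x * ‖u x‖^2 := by
  rw [Complex.sq_norm, Complex.normSq_apply]
  unfold imP Pop Wfun
  rw [Finset.sum_sub_distrib, ← Finset.sum_mul, ← Finset.sum_mul]
  simp only [Complex.add_re, Complex.add_im, Complex.re_sum, Complex.im_sum, Complex.mul_re,
    Complex.mul_im, Complex.ofReal_re, Complex.ofReal_im, Complex.I_re, Complex.I_im]
  ring

/-- The reference energy. -/
def EE {d p : ℕ} (A : Fin d → Rd d → ℝ) (U : Fin p → Rd d → ℝ) (V : Rd d → ℝ)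
    (M : Rd d → ℝ) (u : Rd d → ℂ) : ℝ :=
  (∫ x, ‖Pop A U V u x‖^2) + ∫ x, M x ^ 4 * ‖u x‖^2

lemma EE_nonneg {d p : ℕ} (A : Fin d → Rd d → ℝ) (U : Fin p → Rd d → ℝ) (V : Rd d → ℝ)
    (M : Rd d → ℝ) (u : Rd d → ℂ) : 0 ≤ EE A U V M u :=
  add_nonneg (integral_nonneg fun x => by positivity) (integral_nonneg fun x => by positivity)

section
variable {d p : ℕ} {A : Fin d → Rd d → ℝ} {U : Fin p → Rd d → ℝ} {V : Rd d → ℝ}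
    (hA : ∀ j, SmR (A j)) (hU : ∀ ℓ, SmR (U ℓ)) (hV : SmR V)
    {M : Rd d → ℝ} (hM : SmR M) (hM1 : ∀ x, 1 ≤ M x) {K : ℝ}
    (hMd : ∀ j x, |pdR j M x| ≤ K * M x ^ 2) {u : Rd d → ℂ} (hu : SmC u)
    (hc : HasCompactSupport u)

include hM hu hc in
lemma CC_M4 : CC (fun x => M x ^ 4 * ‖u x‖^2) :=
  CC.mulL (hM.continuous.pow 4) (CC_normsq hu hc)

include hA hu hc in
lemma CC_Q : CC (fun x => ∑ j, ‖Xop A j u x‖^2) :=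
  CC.sum _ fun j _ => CC_normsq (hu.Xop hA j) (hcs_Xop A hc j)

include hA hU hV hu hc in
lemma CC_P : CC (fun x => ‖Pop A U V u x‖^2) :=
  CC_normsq (SmC_Pop hA hU hV hu) (hcs_Pop A U V hc)

lemma sum_reP_aux (x : Rd d) (g : ℝ) (h : Fin d → ℝ) :
    ∑ j, (g * reP (Xop A j (Xop A j u) x) (u x) - g * reP (Xop A j u x) (Xop A j u x)
      + h j * imP (Xop A j u x) (u x))
    = g * (∑ j, reP (Xop A j (Xop A j u) x) (u x)) - g * (∑ j, ‖Xop A j u x‖^2)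
      + ∑ j, h j * imP (Xop A j u x) (u x) := by
  simp only [reP_self]
  rw [Finset.sum_add_distrib, Finset.sum_sub_distrib, Finset.mul_sum, Finset.mul_sum]

include hA hU hV hM hM1 hMd hu hc in
lemma energy :
    ∫ x, (1/2 * (M x ^ 2 * ∑ j, ‖Xop A j u x‖^2) + (M x ^ 2 * ∑ ℓ, (U ℓ x)^2) * ‖u x‖^2)
      ≤ (1/2 + 2 * d * K^2) * EE A U V M u := by
  have hM2 : SmR (fun x => M x ^ 2) := hM.pow 2
  have hQ := CC_Q hA hu hc
  have hP := CC_P hA hU hV hu hc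
  have hM4 := CC_M4 hM hu hc
  have step : ∫ x, (1/2 * (M x ^ 2 * ∑ j, ‖Xop A j u x‖^2)
        + (M x ^ 2 * ∑ ℓ, (U ℓ x)^2) * ‖u x‖^2)
      ≤ ∫ x, (1/2 * ‖Pop A U V u x‖^2 + (1/2 + 2 * d * K^2) * (M x ^ 4 * ‖u x‖^2)) := by
    have hZj : ∀ j, CC _ := fun j => CC_ibpR hA hM2 (hu.Xop hA j) hu hc j
    refine int_le (Z := fun x => ∑ j, (M x ^ 2 * reP (Xop A j (Xop A j u) x) (u x)
        - M x ^ 2 * reP (Xop A j u x) (Xop A j u x)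
        + pdR j (fun y => M y ^ 2) x * imP (Xop A j u x) (u x)) * 1) ?_ ?_ ?_ ?_ ?_
    · refine CC.add (CC.mulL continuous_const (CC.mulL hM2.continuous hQ))
        (CC.mulL ?_ (CC_normsq hu hc))
      exact hM2.continuous.mul (continuous_finsetSum _ fun ℓ _ => (hU ℓ).continuous.pow 2)
    · exact CC.add (CC.mulL continuous_const hP) (CC.mulL continuous_const hM4)
    · refine CC.sum _ fun j _ => ?_
      have := CC.mulL (continuous_const (y := (1:ℝ))) (hZj j)
      simpa only [mul_comm] using this
    · rw [integral_finsetSum]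
      · refine Finset.sum_eq_zero fun j _ => ?_
        rw [integral_mul_const, ibpR hM2 (hu.Xop hA j) hu hc j, zero_mul]
      · intro j _
        exact (hZj j).int.mul_const _
    · intro x
      rw [← Finset.sum_mul, sum_reP_aux]
      have e1 := reP_Pop A U V u x
      have hb := abs_reP (Pop A U V u x) (u x)
      have hM0 : 0 < M x := lt_of_lt_of_le one_pos (hM1 x)
      have hj : ∀ j, pdR j (fun y => M y ^ 2) x * imP (Xop A j u x) (u x)
          ≤ 1/2 * (M x ^ 2 * ‖Xop A j u x‖^2) + 2 * K^2 * (M x ^ 4 * ‖u x‖^2) := by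
        intro j
        rw [pdR_pow hM]
        have h1 := abs_imP (Xop A j u x) (u x)
        have h2 := hMd j x
        have h3 := (abs_nonneg _).trans h2
        calc _ ≤ |(2:ℕ) * M x ^ (2-1) * pdR j M x * imP (Xop A j u x) (u x)| := le_abs_self _
          _ = 2 * M x * |pdR j M x| * |imP (Xop A j u x) (u x)| := by
              rw [abs_mul, abs_mul, abs_mul]; simp [abs_of_pos hM0]
          _ ≤ 2 * M x * (K * M x ^ 2) * (‖Xop A j u x‖ * ‖u x‖) := by gcongr
          _ ≤ _ := by nlinarith [sq_nonneg (M x * ‖Xop A j u x‖ - 2 * K * (M x ^2 * ‖u x‖))]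
      have hs := Finset.sum_le_sum (s := Finset.univ) fun j _ => hj j
      rw [Finset.sum_add_distrib, ← Finset.mul_sum, ← Finset.mul_sum] at hs
      simp only [Finset.sum_const, Finset.card_univ, Fintype.card_fin, nsmul_eq_mul] at hs
      have hp : M x ^ 2 * reP (Pop A U V u x) (u x)
          ≤ 1/2 * ‖Pop A U V u x‖^2 + 1/2 * (M x ^ 4 * ‖u x‖^2) := by
        have : M x ^ 2 * reP (Pop A U V u x) (u x) ≤ M x ^ 2 * (‖Pop A U V u x‖ * ‖u x‖) := by
          gcongr; exact (le_abs_self _).trans hb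
        nlinarith [sq_nonneg (‖Pop A U V u x‖ - M x ^2 * ‖u x‖)]
      rw [e1] at hp
      nlinarith [hs, hp]
  refine step.trans ?_
  rw [integral_add (hP.int.const_mul _) (hM4.int.const_mul _), integral_const_mul,
    integral_const_mul]
  unfold EE
  have h1 : 0 ≤ ∫ x, ‖Pop A U V u x‖^2 := integral_nonneg fun x => by positivity
  have h2 : 0 ≤ 2 * d * K^2 := by positivity
  nlinarith [mul_nonneg h2 h1]

include hA hU hV hM hM1 hMd hu hc in
lemma energyQ :
    ∫ x, (M x ^ 2 * ∑ j, ‖Xop A j u x‖^2) ≤ (1 + 4 * d * K^2) * EE A U V M u := by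
  have h := energy hA hU hV hM hM1 hMd hu hc
  have hM2 : SmR (fun x => M x ^ 2) := hM.pow 2
  have hF : CC (fun x => (M x ^ 2 * ∑ j, ‖Xop A j u x‖^2)) :=
    CC.mulL hM2.continuous (CC_Q hA hu hc)
  have hG : CC (fun x => (M x ^ 2 * ∑ ℓ, (U ℓ x)^2) * ‖u x‖^2) :=
    (CC.mulL (hM2.continuous.mul (continuous_finsetSum _ fun ℓ _ => (hU ℓ).continuous.pow 2))
      (CC_normsq hu hc))
  rw [integral_add (hF.int.const_mul _) hG.int, integral_const_mul] at h
  have h2 : 0 ≤ ∫ x, (M x ^ 2 * ∑ ℓ, (U ℓ x)^2) * ‖u x‖^2 :=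
    integral_nonneg fun x => by positivity
  linarith

include hA hU hV hM hM1 hMd hu hc in
lemma energyU (ℓ : Fin p) :
    ∫ x, (M x ^ 2 * (U ℓ x)^2 * ‖u x‖^2) ≤ (1 + 4 * d * K^2) * EE A U V M u := by
  have h := energy hA hU hV hM hM1 hMd hu hc
  have hM2 : SmR (fun x => M x ^ 2) := hM.pow 2
  have hF : CC (fun x => (M x ^ 2 * ∑ j, ‖Xop A j u x‖^2)) :=
    CC.mulL hM2.continuous (CC_Q hA hu hc)
  have hG : CC (fun x => (M x ^ 2 * ∑ ℓ, (U ℓ x)^2) * ‖u x‖^2) :=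
    (CC.mulL (hM2.continuous.mul (continuous_finsetSum _ fun ℓ _ => (hU ℓ).continuous.pow 2))
      (CC_normsq hu hc))
  have hH : CC (fun x => (M x ^ 2 * (U ℓ x)^2) * ‖u x‖^2) :=
    (CC.mulL (hM2.continuous.mul ((hU ℓ).continuous.pow 2)) (CC_normsq hu hc))
  rw [integral_add (hF.int.const_mul _) hG.int, integral_const_mul] at h
  have h1 : 0 ≤ ∫ x, (M x ^ 2 * ∑ j, ‖Xop A j u x‖^2) :=
    integral_nonneg fun x => by positivity
  have h2 : ∫ x, (M x ^ 2 * (U ℓ x)^2 * ‖u x‖^2)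
      ≤ ∫ x, (M x ^ 2 * ∑ ℓ, (U ℓ x)^2) * ‖u x‖^2 := by
    refine integral_mono hH.int hG.int fun x => ?_
    have := Finset.single_le_sum (f := fun ℓ => (U ℓ x)^2) (fun i _ => sq_nonneg _)
      (Finset.mem_univ ℓ)
    simp only at this ⊢
    gcongr
  have h3 := EE_nonneg A U V M u
  have h4 : 0 ≤ d * K^2 * EE A U V M u := by positivity
  nlinarith

include hA hU hV hM hM1 hMd hu hc in
lemma energyV {L : ℝ} (hL : 0 ≤ L) (hVd : ∀ j x, |pdR j V x| ≤ L * M x ^ 3) :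
    ∫ x, ((V x)^2 * ‖u x‖^2) ≤ (1 + L * (1 + 4 * d * K^2 + d)) * EE A U V M u := by
  have hQ := CC_Q hA hu hc
  have hP := CC_P hA hU hV hu hc
  have hM4 := CC_M4 hM hu hc
  have hMQ : CC (fun x => M x ^ 2 * ∑ j, ‖Xop A j u x‖^2) :=
    CC.mulL (hM.continuous.pow 2) hQ
  have hG1 : CC (fun x => 1/2 * ‖Pop A U V u x‖^2) := CC.mulL continuous_const hP
  have hG2 : CC (fun x => L/2 * (M x ^ 2 * ∑ j, ‖Xop A j u x‖^2)) := CC.mulL continuous_const hMQ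
  have hG3 : CC (fun x => (L*d/2) * (M x ^ 4 * ‖u x‖^2)) := CC.mulL continuous_const hM4
  have step : ∫ x, 1/2 * ((V x)^2 * ‖u x‖^2)
      ≤ ∫ x, (1/2 * ‖Pop A U V u x‖^2 + L/2 * (M x ^ 2 * ∑ j, ‖Xop A j u x‖^2)
        + (L*d/2) * (M x ^ 4 * ‖u x‖^2)) := by
    have hZj : ∀ j, CC _ := fun j => CC_ibpI hA hV (hu.Xop hA j) hu hc j
    refine int_le (Z := fun x => ∑ j, (V x * imP (Xop A j u x) (Xop A j u x)
        - V x * imP (Xop A j (Xop A j u) x) (u x)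
        + pdR j V x * reP (Xop A j u x) (u x)) * (-1)) ?_ ?_ ?_ ?_ ?_
    · exact CC.mulL continuous_const (CC.mulL (hV.continuous.pow 2) (CC_normsq hu hc))
    · exact (hG1.add hG2).add hG3
    · refine CC.sum _ fun j _ => ?_
      have := CC.mulL (continuous_const (y := (-1:ℝ))) (hZj j)
      simpa only [mul_comm] using this
    · rw [integral_finsetSum]
      · refine Finset.sum_eq_zero fun j _ => ?_
        rw [integral_mul_const, ibpI hV (hu.Xop hA j) hu hc j, zero_mul]
      · exact fun j _ => (hZj j).int.mul_const _
    · intro x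
      rw [← Finset.sum_mul]
      simp only [imP_self, mul_zero, zero_sub]
      rw [Finset.sum_add_distrib, Finset.sum_neg_distrib, ← Finset.mul_sum]
      have e1 := imP_Pop A U V u x
      have hb := abs_imP (Pop A U V u x) (u x)
      have hM0 : 0 < M x := lt_of_lt_of_le one_pos (hM1 x)
      have hj : ∀ j, -(pdR j V x * reP (Xop A j u x) (u x))
          ≤ L/2 * (M x ^ 2 * ‖Xop A j u x‖^2) + L/2 * (M x ^ 4 * ‖u x‖^2) := by
        intro j
        have h1 := abs_reP (Xop A j u x) (u x)
        have h2 := hVd j x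
        calc _ ≤ |pdR j V x * reP (Xop A j u x) (u x)| := neg_le_abs _
          _ = |pdR j V x| * |reP (Xop A j u x) (u x)| := abs_mul _ _
          _ ≤ (L * M x ^ 3) * (‖Xop A j u x‖ * ‖u x‖) := by gcongr
          _ ≤ _ := by
            nlinarith [mul_nonneg hL (sq_nonneg (M x * ‖Xop A j u x‖ - (M x ^2 * ‖u x‖)))]
      have hs := Finset.sum_le_sum (s := Finset.univ) fun j _ => hj j
      rw [Finset.sum_neg_distrib, Finset.sum_add_distrib, ← Finset.mul_sum, ← Finset.mul_sum] at hs
      simp only [Finset.sum_const, Finset.card_univ, Fintype.card_fin, nsmul_eq_mul] at hs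
      have hp : V x * imP (Pop A U V u x) (u x)
          ≤ 1/2 * ‖Pop A U V u x‖^2 + 1/2 * ((V x)^2 * ‖u x‖^2) := by
        have : V x * imP (Pop A U V u x) (u x) ≤ |V x| * (‖Pop A U V u x‖ * ‖u x‖) := by
          refine (le_abs_self _).trans ?_
          rw [abs_mul]; gcongr
        have hv : |V x|^2 = (V x)^2 := sq_abs _
        nlinarith [sq_nonneg (‖Pop A U V u x‖ - |V x| * ‖u x‖)]
      rw [e1] at hp
      nlinarith [hs, hp]
  have hq := energyQ hA hU hV hM hM1 hMd hu hc
  rw [integral_add (hG1.add hG2).int hG3.int, integral_add hG1.int hG2.int, integral_const_mul,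
    integral_const_mul, integral_const_mul, integral_const_mul] at step
  have h1 : 0 ≤ ∫ x, ‖Pop A U V u x‖^2 := integral_nonneg fun x => by positivity
  have h2 : 0 ≤ ∫ x, M x ^ 4 * ‖u x‖^2 := integral_nonneg fun x => by positivity
  have hE : EE A U V M u = (∫ x, ‖Pop A U V u x‖^2) + ∫ x, M x ^ 4 * ‖u x‖^2 := rfl
  have h3 := mul_le_mul_of_nonneg_left hq hL
  have h4 : 0 ≤ L * d * ∫ x, ‖Pop A U V u x‖^2 := by positivity
  rw [hE] at h3 ⊢
  nlinarith

include hA hU hV hM hM1 hMd hu hc in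
lemma energyB {L : ℝ} (hL : 0 ≤ L) (j k : Fin d) (hB0 : ∀ x, |magB A j k x| ≤ L * M x ^ 2)
    (hBd : ∀ i x, |pdR i (magB A j k) x| ≤ L * M x ^ 3) :
    ∫ x, ((magB A j k x)^2 * ‖u x‖^2) ≤ (L * (4 + 12 * d * K^2)) * EE A U V M u := by
  have hB : SmR (magB A j k) := ((hA k).pdR j).sub ((hA j).pdR k)
  have hQ := CC_Q hA hu hc
  have hM4 := CC_M4 hM hu hc
  have hMQ : CC (fun x => M x ^ 2 * ∑ j, ‖Xop A j u x‖^2) :=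
    CC.mulL (hM.continuous.pow 2) hQ
  have hG2 : CC (fun x => 3 * L * (M x ^ 2 * ∑ j, ‖Xop A j u x‖^2)) :=
    CC.mulL continuous_const hMQ
  have hG3 : CC (fun x => L * (M x ^ 4 * ‖u x‖^2)) := CC.mulL continuous_const hM4
  have step : ∫ x, ((magB A j k x)^2 * ‖u x‖^2)
      ≤ ∫ x, (3 * L * (M x ^ 2 * ∑ j, ‖Xop A j u x‖^2) + L * (M x ^ 4 * ‖u x‖^2)) := by
    have hZ1 := CC_ibpI hA hB (hu.Xop hA k) hu hc j
    have hZ2 := CC_ibpI hA hB (hu.Xop hA j) hu hc k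
    refine int_le ?_ (hG2.add hG3) (hZ1.sub hZ2) ?_ ?_
    · exact CC.mulL (hB.continuous.pow 2) (CC_normsq hu hc)
    · rw [integral_sub hZ1.int hZ2.int, ibpI hB (hu.Xop hA k) hu hc j,
        ibpI hB (hu.Xop hA j) hu hc k, sub_zero]
    · intro x
      have hM0 : 0 < M x := lt_of_lt_of_le one_pos (hM1 x)
      have e := Xop_comm hA hu j k x
      have hjQ := Finset.single_le_sum (f := fun j => ‖Xop A j u x‖^2) (fun i _ => sq_nonneg _)
        (Finset.mem_univ j)
      have hkQ := Finset.single_le_sum (f := fun j => ‖Xop A j u x‖^2) (fun i _ => sq_nonneg _)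
        (Finset.mem_univ k)
      have b1 : magB A j k x * imP (Xop A k u x) (Xop A j u x)
          ≤ L * M x ^ 2 * (‖Xop A k u x‖ * ‖Xop A j u x‖) := by
        refine (le_abs_self _).trans ?_
        rw [abs_mul]; have := hB0 x; have := abs_imP (Xop A k u x) (Xop A j u x); gcongr
      have b2 : -(magB A j k x * imP (Xop A j u x) (Xop A k u x))
          ≤ L * M x ^ 2 * (‖Xop A j u x‖ * ‖Xop A k u x‖) := by
        refine (neg_le_abs _).trans ?_
        rw [abs_mul]; have := hB0 x; have := abs_imP (Xop A j u x) (Xop A k u x); gcongr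
      have b3 : pdR j (magB A j k) x * reP (Xop A k u x) (u x)
          ≤ L * M x ^ 3 * (‖Xop A k u x‖ * ‖u x‖) := by
        refine (le_abs_self _).trans ?_
        rw [abs_mul]; have := hBd j x; have := abs_reP (Xop A k u x) (u x); gcongr
      have b4 : -(pdR k (magB A j k) x * reP (Xop A j u x) (u x))
          ≤ L * M x ^ 3 * (‖Xop A j u x‖ * ‖u x‖) := by
        refine (neg_le_abs _).trans ?_
        rw [abs_mul]; have := hBd k x; have := abs_reP (Xop A j u x) (u x); gcongr
      have e' : (magB A j k x)^2 * ‖u x‖^2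
          = magB A j k x * imP (Xop A j (Xop A k u) x) (u x)
            - magB A j k x * imP (Xop A k (Xop A j u) x) (u x) := by
        rw [← mul_sub, e]; ring
      have c1 : L * M x ^ 2 * (‖Xop A k u x‖ * ‖Xop A j u x‖)
          ≤ L/2 * (M x ^ 2 * ‖Xop A k u x‖^2) + L/2 * (M x ^ 2 * ‖Xop A j u x‖^2) := by
        nlinarith [mul_nonneg hL (sq_nonneg (M x * ‖Xop A k u x‖ - M x * ‖Xop A j u x‖))]
      have c2 : ∀ i, L * M x ^ 3 * (‖Xop A i u x‖ * ‖u x‖)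
          ≤ L/2 * (M x ^ 2 * ‖Xop A i u x‖^2) + L/2 * (M x ^ 4 * ‖u x‖^2) := by
        intro i
        nlinarith [mul_nonneg hL (sq_nonneg (M x * ‖Xop A i u x‖ - M x ^ 2 * ‖u x‖))]
      have c2j := c2 j
      have c2k := c2 k
      have q1 : L * (M x ^ 2 * ‖Xop A j u x‖^2) ≤ L * (M x ^ 2 * ∑ j, ‖Xop A j u x‖^2) := by
        gcongr
      have q2 : L * (M x ^ 2 * ‖Xop A k u x‖^2) ≤ L * (M x ^ 2 * ∑ j, ‖Xop A j u x‖^2) := by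
        gcongr
      rw [e']
      linarith
  have hq := energyQ hA hU hV hM hM1 hMd hu hc
  rw [integral_add hG2.int hG3.int, integral_const_mul, integral_const_mul] at step
  have h1 : 0 ≤ L * ∫ x, ‖Pop A U V u x‖^2 :=
    mul_nonneg hL (integral_nonneg fun x => by positivity)
  have hE : EE A U V M u = (∫ x, ‖Pop A U V u x‖^2) + ∫ x, M x ^ 4 * ‖u x‖^2 := rfl
  have h3 := mul_le_mul_of_nonneg_left hq hL
  rw [hE] at h3 ⊢
  linarith

set_option maxHeartbeats 1000000 in
include hA hU hV hM hM1 hMd hu hc in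
lemma energyStep (hK : 0 ≤ K) {s L : ℝ} (hs : 0 < s) (hL : 0 ≤ L) (j : Fin d) {φ ψ : Rd d → ℝ}
    (hφ : SmR φ) (hψ : SmR ψ) (hψ0 : ∀ x, |ψ x| ≤ L) (hψd : ∀ x, |pdR j ψ x| ≤ L * M x)
    (hφψ : ∀ x, |M x * ψ x - pdR j φ x| ≤ L * M x * |φ x|)
    (hsm : ∫ x, ((φ x)^2 * (M x ^ 4 * ‖u x‖^2)) ≤ s^2 * EE A U V M u) :
    ∫ x, ((ψ x)^2 * (M x ^ 4 * ‖u x‖^2))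
      ≤ s * ((L * L + 3 * L + 3 * L * K) * (2 + 4 * d * K^2)) * EE A U V M u := by
  set c := L * L + 3 * L + 3 * L * K with hcdef
  have hc0 : 0 ≤ c := by positivity
  have hQ := CC_Q hA hu hc
  have hM4 := CC_M4 hM hu hc
  have hM3 : SmR (fun x => M x ^ 3) := hM.pow 3
  have hg : SmR (fun x => φ x * (ψ x * M x ^ 3)) := hφ.mul (hψ.mul hM3)
  have hMQ : CC (fun x => M x ^ 2 * ∑ j, ‖Xop A j u x‖^2) :=
    CC.mulL (hM.continuous.pow 2) hQ
  have hφM : CC (fun x => (φ x)^2 * (M x ^ 4 * ‖u x‖^2)) := CC.mulL (hφ.continuous.pow 2) hM4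
  have hG1 : CC (fun x => (c / s) * ((φ x)^2 * (M x ^ 4 * ‖u x‖^2))) :=
    CC.mulL continuous_const hφM
  have hG2 : CC (fun x => (c * s / 2) * (M x ^ 4 * ‖u x‖^2)) := CC.mulL continuous_const hM4
  have hG3 : CC (fun x => (c * s / 2) * (M x ^ 2 * ∑ j, ‖Xop A j u x‖^2)) :=
    CC.mulL continuous_const hMQ
  have step : ∫ x, ((ψ x)^2 * (M x ^ 4 * ‖u x‖^2))
      ≤ ∫ x, ((c / s) * ((φ x)^2 * (M x ^ 4 * ‖u x‖^2)) + (c * s / 2) * (M x ^ 4 * ‖u x‖^2)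
          + (c * s / 2) * (M x ^ 2 * ∑ j, ‖Xop A j u x‖^2)) := by
    have hZ := CC.mulL (continuous_const (y := (-1:ℝ))) (CC_ibpI hA hg hu hu hc j)
    refine int_le ?_ ((hG1.add hG2).add hG3) hZ ?_ ?_
    · exact CC.mulL (hψ.continuous.pow 2) hM4
    · rw [integral_const_mul, ibpI hg hu hu hc j, mul_zero]
    · intro x
      have hM0 : 0 < M x := lt_of_lt_of_le one_pos (hM1 x)
      rw [pdR_mul hφ (hψ.mul hM3), pdR_mul hψ hM3, pdR_pow hM, reP_self]
      have hjQ := Finset.single_le_sum (f := fun j => ‖Xop A j u x‖^2) (fun i _ => sq_nonneg _)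
        (Finset.mem_univ j)
      have i1 := abs_imP (Xop A j u x) (u x)
      have i2 : imP (u x) (Xop A j u x) = - imP (Xop A j u x) (u x) := by unfold imP; ring
      rw [i2]
      have n1 := hψ0 x
      have n2 := hψd x
      have n3 := hφψ x
      have n4 := hMd j x
      set I := imP (Xop A j u x) (u x)
      set a := |φ x| * (M x ^ 2 * ‖u x‖) with ha
      have b1 : ψ x * M x ^ 3 * (M x * ψ x - pdR j φ x) * ‖u x‖^2
          ≤ L * M x ^ 3 * (L * M x * |φ x|) * ‖u x‖^2 := by
        refine mul_le_mul_of_nonneg_right ?_ (by positivity)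
        refine (le_abs_self _).trans ?_
        rw [abs_mul, abs_mul, abs_of_pos (pow_pos hM0 3)]
        gcongr
      have b2 : -(φ x * pdR j ψ x * M x ^ 3 * ‖u x‖^2)
          ≤ |φ x| * (L * M x) * M x ^ 3 * ‖u x‖^2 := by
        rw [← neg_mul]
        refine mul_le_mul_of_nonneg_right ?_ (by positivity)
        refine (neg_le_abs _).trans ?_
        rw [abs_mul, abs_mul, abs_of_pos (pow_pos hM0 3)]
        gcongr
      have b3 : -(φ x * ψ x * pdR j M x * (3 * M x ^ 2 * ‖u x‖^2))
          ≤ |φ x| * L * (K * M x ^ 2) * (3 * M x ^ 2 * ‖u x‖^2) := by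
        rw [← neg_mul]
        refine mul_le_mul_of_nonneg_right ?_ (by positivity)
        refine (neg_le_abs _).trans ?_
        rw [abs_mul, abs_mul]
        gcongr
      have b4 : φ x * ψ x * I * (2 * M x ^ 3)
          ≤ |φ x| * L * (‖Xop A j u x‖ * ‖u x‖) * (2 * M x ^ 3) := by
        refine mul_le_mul_of_nonneg_right ?_ (by positivity)
        refine (le_abs_self _).trans ?_
        rw [abs_mul, abs_mul]
        gcongr
      have tot : (ψ x)^2 * (M x ^ 4 * ‖u x‖^2) + -1 * (φ x * (ψ x * M x ^ 3) * (-I)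
          - φ x * (ψ x * M x ^ 3) * I + (pdR j φ x * (ψ x * M x ^ 3)
          + φ x * (pdR j ψ x * M x ^ 3 + ψ x * ((3:ℕ) * M x ^ (3-1) * pdR j M x))) * ‖u x‖^2)
          ≤ c * (a * (M x ^ 2 * ‖u x‖)) + c * (a * (M x * ‖Xop A j u x‖)) := by
        have t1 : L * M x ^ 3 * (L * M x * |φ x|) * ‖u x‖^2
          + |φ x| * (L * M x) * M x ^ 3 * ‖u x‖^2
          + |φ x| * L * (K * M x ^ 2) * (3 * M x ^ 2 * ‖u x‖^2)
          ≤ c * (a * (M x ^ 2 * ‖u x‖)) := by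
          have : L * M x ^ 3 * (L * M x * |φ x|) * ‖u x‖^2
            + |φ x| * (L * M x) * M x ^ 3 * ‖u x‖^2
            + |φ x| * L * (K * M x ^ 2) * (3 * M x ^ 2 * ‖u x‖^2)
            = (L * L + L + 3 * L * K) * (a * (M x ^ 2 * ‖u x‖)) := by rw [ha]; ring
          rw [this]
          have : L * L + L + 3 * L * K ≤ c := by rw [hcdef]; linarith
          gcongr
        have t2 : |φ x| * L * (‖Xop A j u x‖ * ‖u x‖) * (2 * M x ^ 3)
            ≤ c * (a * (M x * ‖Xop A j u x‖)) := by
          have : |φ x| * L * (‖Xop A j u x‖ * ‖u x‖) * (2 * M x ^ 3)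
            = (2 * L) * (a * (M x * ‖Xop A j u x‖)) := by rw [ha]; ring
          rw [this]
          have : 2 * L ≤ c := by
            rw [hcdef]; nlinarith [mul_nonneg hL hL, mul_nonneg hL hK]
          gcongr
        push_cast
        linarith [b1, b2, b3, b4, t1, t2]
      refine tot.trans ?_
      have hy : ∀ b : ℝ, a * b ≤ a^2 / (2*s) + s/2 * b^2 := by
        intro b
        have : a^2 / (2*s) + s/2 * b^2 - a * b = (a - s*b)^2 / (2*s) := by field_simp; ring
        have h2 : 0 ≤ (a - s*b)^2 / (2*s) := by positivity
        linarith
      have y1 : c * (a * (M x ^ 2 * ‖u x‖))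
          ≤ c * (a^2 / (2*s)) + (c * s / 2) * (M x ^ 4 * ‖u x‖^2) :=
        (mul_le_mul_of_nonneg_left (hy (M x ^ 2 * ‖u x‖)) hc0).trans (le_of_eq (by ring))
      have y2 : c * (a * (M x * ‖Xop A j u x‖))
          ≤ c * (a^2 / (2*s)) + (c * s / 2) * (M x ^ 2 * ‖Xop A j u x‖^2) :=
        (mul_le_mul_of_nonneg_left (hy (M x * ‖Xop A j u x‖)) hc0).trans (le_of_eq (by ring))
      have ha2 : a^2 = (φ x)^2 * (M x ^ 4 * ‖u x‖^2) := by
        rw [ha, mul_pow, sq_abs]; ring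
      have e1 : c * (a^2 / (2*s)) + c * (a^2 / (2*s)) = (c / s) * a^2 := by field_simp; ring
      have q1 : (c * s / 2) * (M x ^ 2 * ‖Xop A j u x‖^2)
          ≤ (c * s / 2) * (M x ^ 2 * ∑ j, ‖Xop A j u x‖^2) := by
        gcongr
      rw [← ha2]
      linarith [y1, y2, e1, q1]
  have hq := energyQ hA hU hV hM hM1 hMd hu hc
  rw [integral_add (hG1.add hG2).int hG3.int, integral_add hG1.int hG2.int, integral_const_mul,
    integral_const_mul, integral_const_mul] at step
  have hE : EE A U V M u = (∫ x, ‖Pop A U V u x‖^2) + ∫ x, M x ^ 4 * ‖u x‖^2 := rfl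
  have h1 : 0 ≤ ∫ x, ‖Pop A U V u x‖^2 := integral_nonneg fun x => by positivity
  have m1 : (c / s) * (∫ x, ((φ x)^2 * (M x ^ 4 * ‖u x‖^2))) ≤ (c * s) * EE A U V M u := by
    calc _ ≤ (c / s) * (s^2 * EE A U V M u) := by gcongr
      _ = _ := by field_simp
  have m2 : (c * s / 2) * (∫ x, M x ^ 4 * ‖u x‖^2) ≤ (c * s / 2) * EE A U V M u := by
    have : (∫ x, M x ^ 4 * ‖u x‖^2) ≤ EE A U V M u := by linarith
    gcongr
  have m3 : (c * s / 2) * (∫ x, M x ^ 2 * ∑ j, ‖Xop A j u x‖^2)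
      ≤ (c * s / 2) * ((1 + 4 * d * K^2) * EE A U V M u) := by gcongr
  have m4 : 0 ≤ c * s * (d * K^2) * EE A U V M u := by
    have := EE_nonneg A U V M u
    positivity
  nlinarith
end

/-! ### The smooth weight -/

/-- The base function under the root. -/
def GG {d : ℕ} {ι : Type*} (S : Finset ι) (f : ι → Rd d → ℝ) (w : ι → ℕ) (N : ℕ) (μ : ℝ)
    (x : Rd d) : ℝ := 1 + ∑ i ∈ S, (f i x * μ⁻¹) ^ (2 * (N / w i))

/-- The smooth weight, an even root of `GG`. -/
def MM {d : ℕ} {ι : Type*} (S : Finset ι) (f : ι → Rd d → ℝ) (w : ι → ℕ) (N : ℕ) (μ : ℝ)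
    (x : Rd d) : ℝ := (GG S f w N μ x) ^ (((2 * N : ℕ) : ℝ)⁻¹)

/-- The normalised coefficient `f_i / (μ M^{w_i})`. -/
def ph {d : ℕ} {ι : Type*} (S : Finset ι) (f : ι → Rd d → ℝ) (w : ι → ℕ) (N : ℕ) (μ : ℝ)
    (i : ι) (x : Rd d) : ℝ := f i x / (μ * MM S f w N μ x ^ (w i))

section
variable {d : ℕ} {ι : Type*} {S : Finset ι} {f : ι → Rd d → ℝ} {w : ι → ℕ} {N : ℕ} {μ : ℝ}
  (hf : ∀ i, SmR (f i)) (hw : ∀ i ∈ S, 1 ≤ w i ∧ w i ∣ N) (hN : 2 ≤ N) (hμ : 1 ≤ μ)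

lemma GG_one (x : Rd d) : 1 ≤ GG S f w N μ x := by
  unfold GG
  have : 0 ≤ ∑ i ∈ S, (f i x * μ⁻¹) ^ (2 * (N / w i)) :=
    Finset.sum_nonneg fun i _ => by rw [pow_mul]; positivity
  linarith

lemma MM_one (x : Rd d) : 1 ≤ MM S f w N μ x :=
  Real.one_le_rpow (GG_one x) (by positivity)

include hN in
lemma MM_pow (x : Rd d) : MM S f w N μ x ^ (2 * N) = GG S f w N μ x :=
  Real.rpow_inv_natCast_pow (le_trans zero_le_one (GG_one x)) (by omega)

include hf in
lemma GG_sm : SmR (GG S f w N μ) := by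
  unfold GG
  exact contDiff_const.add (ContDiff.sum fun i _ => ((hf i).mul contDiff_const).pow _)

include hf in
lemma MM_sm : SmR (MM S f w N μ) := by
  unfold MM
  exact (GG_sm hf).rpow_const_of_ne fun x => ne_of_gt (lt_of_lt_of_le one_pos (GG_one x))

include hw in
lemma two_mul_div {i : ι} (hi : i ∈ S) : w i * (2 * (N / w i)) = 2 * N := by
  obtain ⟨k, hk⟩ := (hw i hi).2
  have := (hw i hi).1
  have h2 : N / w i = k := by rw [hk]; exact Nat.mul_div_cancel_left k (by omega)
  rw [h2, hk]; ring

include hw hN in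
lemma div_ge {i : ι} (hi : i ∈ S) : 1 ≤ N / w i := by
  obtain ⟨k, hk⟩ := (hw i hi).2
  have := (hw i hi).1
  have h2 : N / w i = k := by rw [hk]; exact Nat.mul_div_cancel_left k (by omega)
  rw [h2]
  rcases Nat.eq_zero_or_pos k with h | h
  · subst h; omega
  · exact h

include hw hN in
lemma f_le {i : ι} (hi : i ∈ S) (x : Rd d) : |f i x * μ⁻¹| ≤ MM S f w N μ x ^ (w i) := by
  have h0 : 0 ≤ MM S f w N μ x := le_trans zero_le_one (MM_one x)
  have hn : 2 * (N / w i) ≠ 0 := by have := div_ge hw hN hi; omega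
  rw [← pow_le_pow_iff_left₀ (abs_nonneg _) (pow_nonneg h0 _) hn, ← pow_mul,
    two_mul_div hw hi, MM_pow hN, pow_abs, abs_of_nonneg (by rw [pow_mul]; positivity)]
  have := Finset.single_le_sum (f := fun i => (f i x * μ⁻¹) ^ (2 * (N / w i)))
    (fun i _ => by rw [pow_mul]; positivity) hi
  unfold GG
  linarith

lemma pdR_sum {κ : Type*} (s : Finset κ) {g : κ → Rd d → ℝ} (hg : ∀ i, SmR (g i)) (j : Fin d)
    (x : Rd d) : pdR j (fun y => ∑ i ∈ s, g i y) x = ∑ i ∈ s, pdR j (g i) x := by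
  unfold pdR
  rw [fderiv_fun_sum fun i _ => (hg i).da x]
  simp

lemma pdR_const (c : ℝ) (j : Fin d) (x : Rd d) : pdR j (fun _ => c) x = 0 := by simp [pdR]

include hf hw hN hμ in
lemma MM_deriv {K : ℝ} (hd : ∀ i ∈ S, ∀ j x, |pdR j (f i) x| ≤ K * μ * MM S f w N μ x ^ (w i + 1))
    (j : Fin d) (x : Rd d) : |pdR j (MM S f w N μ) x| ≤ (S.card * K) * MM S f w N μ x ^ 2 := by
  set M := MM S f w N μ with hM
  have hM0 : 0 < M x := lt_of_lt_of_le one_pos (MM_one x)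
  have hμ0 : 0 < μ := by linarith
  have e : (fun y => M y ^ (2 * N)) = fun y => 1 + ∑ i ∈ S, (f i y * μ⁻¹) ^ (2 * (N / w i)) := by
    funext y; exact MM_pow hN y
  have hsm : ∀ i, SmR (fun y => (f i y * μ⁻¹)) := fun i => (hf i).mul contDiff_const
  have e2 : ((2 * N : ℕ) : ℝ) * M x ^ (2 * N - 1) * pdR j M x
      = ∑ i ∈ S, ((2 * (N / w i) : ℕ) : ℝ) * (f i x * μ⁻¹) ^ (2 * (N / w i) - 1)
        * (pdR j (f i) x * μ⁻¹) := by
    rw [← pdR_pow (MM_sm hf), e, pdR_add contDiff_const (ContDiff.sum fun i _ => (hsm i).pow _),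
      pdR_const, zero_add, pdR_sum S (fun i => (hsm i).pow _)]
    refine Finset.sum_congr rfl fun i _ => ?_
    rw [pdR_pow (hsm i), pdR_mul (hf i) contDiff_const, pdR_const, mul_zero, add_zero]
  have hterm : ∀ i ∈ S, |((2 * (N / w i) : ℕ) : ℝ) * (f i x * μ⁻¹) ^ (2 * (N / w i) - 1)
        * (pdR j (f i) x * μ⁻¹)| ≤ ((2 * N : ℕ) : ℝ) * K * M x ^ (2 * N + 1) := by
    intro i hi
    have hdi := hd i hi j x
    have hKn : 0 ≤ K := by
      have h1 := (abs_nonneg _).trans hdi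
      have h2 : 0 < μ * M x ^ (w i + 1) := by positivity
      by_contra hK
      push Not at hK
      have : K * μ * M x ^ (w i + 1) < 0 := by
        rw [mul_assoc]; exact mul_neg_of_neg_of_pos hK h2
      linarith
    have h1 : |pdR j (f i) x * μ⁻¹| ≤ K * M x ^ (w i + 1) := by
      rw [abs_mul, abs_of_pos (inv_pos.2 hμ0), ← div_eq_mul_inv, div_le_iff₀ hμ0]
      linarith
    rw [abs_mul, abs_mul, abs_pow, Nat.abs_cast]
    have h2 := f_le (f := f) (μ := μ) hw hN hi x
    have h3 : ((2 * (N / w i) : ℕ) : ℝ) ≤ ((2 * N : ℕ) : ℝ) := by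
      exact_mod_cast Nat.mul_le_mul_left 2 (Nat.div_le_self _ _)
    calc _ ≤ ((2 * N : ℕ) : ℝ) * (M x ^ (w i)) ^ (2 * (N / w i) - 1) * (K * M x ^ (w i + 1)) := by
          gcongr
      _ = ((2 * N : ℕ) : ℝ) * K * (((M x ^ (w i)) ^ (2 * (N / w i) - 1) * M x ^ (w i)) * M x) := by
          rw [pow_succ (M x) (w i)]; ring
      _ = _ := by
          have := div_ge hw hN hi
          rw [← pow_succ (M x ^ (w i)), Nat.sub_add_cancel (by omega), ← pow_mul,
            two_mul_div hw hi, ← pow_succ]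
  have hsum : |((2 * N : ℕ) : ℝ) * M x ^ (2 * N - 1) * pdR j M x|
      ≤ S.card * (((2 * N : ℕ) : ℝ) * K * M x ^ (2 * N + 1)) := by
    rw [e2]
    refine (Finset.abs_sum_le_sum_abs _ _).trans ?_
    refine (Finset.sum_le_sum hterm).trans ?_
    rw [Finset.sum_const, nsmul_eq_mul]
  rw [abs_mul, abs_mul, Nat.abs_cast, abs_of_pos (pow_pos hM0 _)] at hsum
  have hpos : 0 < ((2 * N : ℕ) : ℝ) * M x ^ (2 * N - 1) := by
    have : 0 < 2 * N := by omega
    have : (0:ℝ) < ((2 * N : ℕ) : ℝ) := by exact_mod_cast this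
    positivity
  have e3 : M x ^ (2 * N + 1) = M x ^ (2 * N - 1) * M x ^ 2 := by
    rw [← pow_add]; congr 1; omega
  rw [e3] at hsum
  refine le_of_mul_le_mul_left ?_ hpos
  linarith

include hf hμ in
lemma ph_sm (i : ι) : SmR (ph S f w N μ i) := by
  unfold ph
  refine (hf i).div (contDiff_const.mul ((MM_sm hf).pow _)) fun x => ?_
  have := lt_of_lt_of_le one_pos (MM_one (S := S) (f := f) (w := w) (N := N) (μ := μ) x)
  have : 0 < μ := by linarith
  positivity

lemma ph_mul (hμ : 1 ≤ μ) (i : ι) (x : Rd d) :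
    ph S f w N μ i x * MM S f w N μ x ^ (w i) = f i x * μ⁻¹ := by
  have := lt_of_lt_of_le one_pos (MM_one (S := S) (f := f) (w := w) (N := N) (μ := μ) x)
  have : 0 < μ := by linarith
  unfold ph
  field_simp

include hw hN hμ in
lemma ph_le {i : ι} (hi : i ∈ S) (x : Rd d) : |ph S f w N μ i x| ≤ 1 := by
  have h0 := lt_of_lt_of_le one_pos (MM_one (S := S) (f := f) (w := w) (N := N) (μ := μ) x)
  have h := f_le (f := f) (μ := μ) hw hN hi x
  rw [← ph_mul hμ, abs_mul, abs_of_pos (pow_pos h0 _)] at h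
  have h2 := pow_pos h0 (w i)
  by_contra hc
  push Not at hc
  nlinarith

include hf hμ in
lemma ph_deriv {i : ι} (hi : 1 ≤ w i) (j : Fin d) (x : Rd d) :
    pdR j (ph S f w N μ i) x = pdR j (f i) x / (μ * MM S f w N μ x ^ (w i))
      - w i * ph S f w N μ i x * (pdR j (MM S f w N μ) x / MM S f w N μ x) := by
  have h0 := lt_of_lt_of_le one_pos (MM_one (S := S) (f := f) (w := w) (N := N) (μ := μ) x)
  have hμ0 : 0 < μ := by linarith
  have e : (fun y => ph S f w N μ i y * MM S f w N μ y ^ (w i)) = fun y => f i y * μ⁻¹ := by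
    funext y; exact ph_mul hμ i y
  have e2 := congrArg (fun g => pdR j g x) e
  rw [pdR_mul (ph_sm hf hμ i) ((MM_sm hf).pow _), pdR_pow (MM_sm hf),
    pdR_mul (hf i) contDiff_const, pdR_const, mul_zero, add_zero] at e2
  obtain ⟨n, hn⟩ : ∃ n, w i = n + 1 := ⟨w i - 1, by omega⟩
  rw [hn] at e2 ⊢
  simp only [Nat.add_sub_cancel] at e2
  generalize MM S f w N μ x = m at *
  generalize pdR j (ph S f w N μ i) x = a at *
  generalize ph S f w N μ i x = b at *
  have hm : m ^ (n+1) ≠ 0 := (pow_pos h0 _).ne'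
  have : a = (pdR j (f i) x * μ⁻¹ - b * (((n+1:ℕ):ℝ) * m ^ n * pdR j (MM S f w N μ) x))
      / m ^ (n+1) := by
    rw [eq_div_iff hm]; linarith
  rw [this, sub_div]
  congr 1
  · field_simp
  · field_simp
    ring

include hw hN hμ in
lemma M4_le (x : Rd d) : MM S f w N μ x ^ 4
    ≤ 1 + ∑ i ∈ S, (ph S f w N μ i x)^2 * MM S f w N μ x ^ 4 := by
  have h1 := MM_one (S := S) (f := f) (w := w) (N := N) (μ := μ) x
  have h := MM_pow (S := S) (f := f) (w := w) (μ := μ) hN x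
  have hi : ∀ i ∈ S, (f i x * μ⁻¹) ^ (2 * (N / w i))
      ≤ (ph S f w N μ i x)^2 * MM S f w N μ x ^ (2 * N) := by
    intro i hi
    rw [← ph_mul hμ (S := S) (w := w) (N := N), mul_pow, ← pow_mul, two_mul_div hw hi]
    refine mul_le_mul_of_nonneg_right ?_ (by positivity)
    rw [pow_mul]
    have hp := ph_le (f := f) hw hN hμ hi x
    have hp2 : (ph S f w N μ i x)^2 ≤ 1 := by
      rw [← sq_abs]; exact pow_le_one₀ (abs_nonneg _) hp
    have := pow_le_pow_of_le_one (sq_nonneg _) hp2 (div_ge hw hN hi)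
    simpa using this
  have hs := Finset.sum_le_sum hi
  rw [← Finset.sum_mul] at hs ⊢
  unfold GG at h
  set m := MM S f w N μ x
  set T := ∑ i ∈ S, (ph S f w N μ i x)^2
  have h4 : m ^ 4 ≤ m ^ (2 * N) := pow_le_pow_right₀ h1 (by omega)
  have hpos : 0 < m ^ (2 * N) := by positivity
  have h5 : m ^ (2 * N) ≤ 1 + T * m ^ (2 * N) := by linarith
  refine le_of_mul_le_mul_left ?_ hpos
  have h6 : 0 ≤ m ^ 4 := by positivity
  nlinarith [mul_le_mul_of_nonneg_right h5 h6]
end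

/-! ### The concrete family of coefficients -/

abbrev Bt (d p : ℕ) := Fin p ⊕ ({jk : Fin d × Fin d // jk.1 < jk.2} ⊕ Unit)

abbrev It (d p : ℕ) := Bt d p × (Fin d → ℕ)

/-- base functions `U_ℓ`, `B_{jk}`, `V` -/
def bs {d p : ℕ} (A : Fin d → Rd d → ℝ) (U : Fin p → Rd d → ℝ) (V : Rd d → ℝ) :
    Bt d p → Rd d → ℝ :=
  Sum.elim U (Sum.elim (fun jk => magB A jk.1.1 jk.1.2) (fun _ => V))

/-- base weights -/
def bw {d p : ℕ} : Bt d p → ℕ := Sum.elim (fun _ => 1) (fun _ => 2)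

def ff {d p : ℕ} (A : Fin d → Rd d → ℝ) (U : Fin p → Rd d → ℝ) (V : Rd d → ℝ)
    (i : It d p) : Rd d → ℝ := pdMulti i.2 (bs A U V i.1)

def wt {d p : ℕ} (i : It d p) : ℕ := bw i.1 + ∑ j, i.2 j

def SS (d p r : ℕ) : Finset (It d p) :=
  (Finset.univ ×ˢ (Finset.range (r+1)).biUnion (mIdx d)).filter (fun i => wt i ≤ r + 1)

lemma mem_mIdx {d q : ℕ} {α : Fin d → ℕ} : α ∈ mIdx d q ↔ ∑ j, α j = q :=
  Finset.Nat.mem_antidiagonalTuple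

lemma bw_pos {d p : ℕ} (b : Bt d p) : 1 ≤ bw b := by
  rcases b with b | b <;> simp [bw]

lemma mem_SS {d p r : ℕ} {i : It d p} : i ∈ SS d p r ↔ wt i ≤ r + 1 := by
  unfold SS
  simp only [Finset.mem_filter, Finset.mem_product, Finset.mem_univ, true_and,
    Finset.mem_biUnion, Finset.mem_range, and_iff_right_iff_imp]
  intro h
  refine ⟨∑ j, i.2 j, ?_, mem_mIdx.2 rfl⟩
  have := bw_pos i.1
  unfold wt at h
  omega

section
variable {d p r : ℕ} {A : Fin d → Rd d → ℝ} {U : Fin p → Rd d → ℝ} {V : Rd d → ℝ}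
    (hA : ∀ j, SmR (A j)) (hU : ∀ ℓ, SmR (U ℓ)) (hV : SmR V)

include hA in
lemma magB_sm (j k : Fin d) : SmR (magB A j k) := ((hA k).pdR j).sub ((hA j).pdR k)

include hA hU hV in
lemma bs_sm (b : Bt d p) : SmR (bs A U V b) := by
  rcases b with l | jk | _
  · exact hU l
  · exact magB_sm hA _ _
  · exact hV

include hA hU hV in
lemma ff_sm (i : It d p) : SmR (ff A U V i) := (bs_sm hA hU hV i.1).pdMulti _

include hA hU hV in
lemma pdR_ff (i : It d p) (j : Fin d) :
    pdR j (ff A U V i) = ff A U V (i.1, i.2 + Pi.single j 1) :=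
  pdR_pdMulti (bs_sm hA hU hV i.1) _ _

lemma wt_succ (b : Bt d p) (α : Fin d → ℕ) (j : Fin d) :
    wt (b, α + Pi.single j 1) = wt (b, α) + 1 := by
  unfold wt
  simp only [Pi.add_apply, Finset.sum_add_distrib]
  rw [Finset.sum_pi_single']
  simp; ring

lemma ff_le_mq {q : ℕ} (i : It d p) (hi : wt i = q + 2) (x : Rd d) :
    |ff A U V i x| ≤ mq A U V (q+1) x := by
  obtain ⟨b, α⟩ := i
  have n1 : 0 ≤ ∑ ℓ, ∑ α ∈ mIdx d (q+1), |pdMulti α (U ℓ) x| :=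
    Finset.sum_nonneg fun _ _ => Finset.sum_nonneg fun _ _ => abs_nonneg _
  have n2 : 0 ≤ ∑ jk ∈ Finset.univ.filter (fun jk : Fin d × Fin d => jk.1 < jk.2),
          ∑ α ∈ mIdx d q, |pdMulti α (magB A jk.1 jk.2) x| :=
    Finset.sum_nonneg fun _ _ => Finset.sum_nonneg fun _ _ => abs_nonneg _
  have n3 : 0 ≤ ∑ α ∈ mIdx d q, |pdMulti α V x| := Finset.sum_nonneg fun _ _ => abs_nonneg _
  unfold mq
  rcases b with l | jk | _
  · have hα : α ∈ mIdx d (q+1) := by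
      rw [mem_mIdx]; simp [wt, bw] at hi; omega
    have h1 := Finset.single_le_sum (f := fun α => |pdMulti α (U l) x|)
      (fun _ _ => abs_nonneg _) hα
    have h2 := Finset.single_le_sum (f := fun l => ∑ α ∈ mIdx d (q+1), |pdMulti α (U l) x|)
      (fun _ _ => Finset.sum_nonneg fun _ _ => abs_nonneg _) (Finset.mem_univ l)
    have h3 : |ff A U V (Sum.inl l, α) x| = |pdMulti α (U l) x| := rfl
    linarith
  · have hα : α ∈ mIdx d q := by
      rw [mem_mIdx]; simp [wt, bw] at hi; omega
    have h1 := Finset.single_le_sum (f := fun α => |pdMulti α (magB A jk.1.1 jk.1.2) x|)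
      (fun _ _ => abs_nonneg _) hα
    have h2 := Finset.single_le_sum
      (f := fun jk : Fin d × Fin d => ∑ α ∈ mIdx d q, |pdMulti α (magB A jk.1 jk.2) x|)
      (s := Finset.univ.filter (fun jk : Fin d × Fin d => jk.1 < jk.2))
      (fun _ _ => Finset.sum_nonneg fun _ _ => abs_nonneg _) (a := jk.1)
      (by simpa using jk.2)
    have h3 : |ff A U V (Sum.inr (Sum.inl jk), α) x|
      = |pdMulti α (magB A jk.1.1 jk.1.2) x| := rfl
    linarith
  · have hα : α ∈ mIdx d q := by
      rw [mem_mIdx]; simp [wt, bw] at hi; omega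
    have h1 := Finset.single_le_sum (f := fun α => |pdMulti α V x|)
      (fun _ _ => abs_nonneg _) hα
    have h3 : ∀ c, |ff A U V (Sum.inr (Sum.inr c), α) x| = |pdMulti α V x| := fun _ => rfl
    rw [h3]
    linarith

lemma sum_le_card {κ : Type*} (s : Finset κ) (f : κ → ℝ) (T : ℝ) (h : ∀ i ∈ s, f i ≤ T) :
    ∑ i ∈ s, f i ≤ s.card * T := by
  have := Finset.sum_le_card_nsmul s f T h
  rwa [nsmul_eq_mul] at this

lemma mq_le (q : ℕ) (hq : q ≤ r) : ∃ D : ℝ, 0 ≤ D ∧ ∀ (x : Rd d) (T : ℝ),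
    (∀ i ∈ SS d p r, |ff A U V i x| ≤ T) → mq A U V q x ≤ D * T := by
  cases q with
  | zero =>
    refine ⟨(Finset.univ : Finset (Fin p)).card, by positivity, fun x T hT => ?_⟩
    unfold mq
    refine sum_le_card _ _ _ fun l _ => ?_
    have := hT (Sum.inl l, 0) (by rw [mem_SS]; simp [wt, bw])
    unfold ff at this
    rwa [pdMulti_zero] at this
  | succ q =>
    refine ⟨(Finset.univ : Finset (Fin p)).card * (mIdx d (q+1)).card
      + (Finset.univ.filter (fun jk : Fin d × Fin d => jk.1 < jk.2)).card * (mIdx d q).card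
      + (mIdx d q).card, by positivity, fun x T hT => ?_⟩
    unfold mq
    rw [add_mul, add_mul, mul_assoc, mul_assoc]
    refine add_le_add (add_le_add ?_ ?_) ?_
    · refine sum_le_card _ _ _ fun l _ => sum_le_card _ _ _ fun α hα => ?_
      rw [mem_mIdx] at hα
      exact hT (Sum.inl l, α) (by rw [mem_SS]; simp [wt, bw]; omega)
    · refine sum_le_card _ _ _ fun jk hjk => sum_le_card _ _ _ fun α hα => ?_
      rw [mem_mIdx] at hα
      exact hT (Sum.inr (Sum.inl ⟨jk, by simpa using hjk⟩), α)
        (by rw [mem_SS]; simp [wt, bw]; omega)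
    · refine sum_le_card _ _ _ fun α hα => ?_
      rw [mem_mIdx] at hα
      exact hT (Sum.inr (Sum.inr ()), α) (by rw [mem_SS]; simp [wt, bw]; omega)

lemma mr_le {d p : ℕ} (A : Fin d → Rd d → ℝ) (U : Fin p → Rd d → ℝ) (V : Rd d → ℝ) (r : ℕ) : ∃ D : ℝ, 0 ≤ D ∧ ∀ (x : Rd d) (T : ℝ),
    (∀ i ∈ SS d p r, |ff A U V i x| ≤ T) → mr A U V r x ≤ 1 + D * T := by
  have h : ∀ q, ∃ D : ℝ, 0 ≤ D ∧ (q ≤ r → ∀ (x : Rd d) (T : ℝ),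
    (∀ i ∈ SS d p r, |ff A U V i x| ≤ T) → mq A U V q x ≤ D * T) := by
    intro q
    by_cases hq : q ≤ r
    · obtain ⟨D, h1, h2⟩ := mq_le (A := A) (U := U) (V := V) (r := r) q hq
      exact ⟨D, h1, fun _ => h2⟩
    · exact ⟨0, le_rfl, fun h => absurd h hq⟩
  choose D h1 h2 using h
  refine ⟨∑ q ∈ Finset.range (r+1), D q, Finset.sum_nonneg fun q _ => h1 q, fun x T hT => ?_⟩
  unfold mr
  rw [Finset.sum_mul]
  have := Finset.sum_le_sum (s := Finset.range (r+1)) fun q hq =>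
    h2 q (by rw [Finset.mem_range] at hq; omega) x T hT
  linarith

lemma Phi_le {d p : ℕ} (A : Fin d → Rd d → ℝ) (U : Fin p → Rd d → ℝ) (V : Rd d → ℝ) (r : ℕ) : ∃ D : ℝ, 0 ≤ D ∧ ∀ (x : Rd d) (t T : ℝ), 0 ≤ T →
    (∀ i ∈ SS d p r, t ^ (wt i) * |ff A U V i x| ≤ T) → Phi A U V r x t ≤ D * T := by
  refine ⟨(Finset.univ : Finset (Fin p)).card * (∑ q ∈ Finset.range (r+1), ((mIdx d q).card : ℝ))
      + (Finset.univ.filter (fun jk : Fin d × Fin d => jk.1 < jk.2)).card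
        * (∑ q ∈ Finset.range r, ((mIdx d q).card : ℝ))
      + ∑ q ∈ Finset.range r, ((mIdx d q).card : ℝ), by positivity, fun x t T _ hT => ?_⟩
  unfold Phi
  rw [add_mul, add_mul, mul_assoc, mul_assoc, Finset.sum_mul, Finset.sum_mul]
  refine add_le_add (add_le_add ?_ ?_) ?_
  · refine sum_le_card _ _ _ fun l _ => Finset.sum_le_sum fun q hq => ?_
    rw [Finset.mul_sum]
    refine sum_le_card _ _ _ fun α hα => ?_
    rw [mem_mIdx] at hα
    rw [Finset.mem_range] at hq
    have hw : wt ((Sum.inl l : Bt d p), α) = q + 1 := by simp [wt, bw]; omega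
    have := hT (Sum.inl l, α) (by rw [mem_SS]; omega)
    rwa [hw] at this
  · refine sum_le_card _ _ _ fun jk hjk => Finset.sum_le_sum fun q hq => ?_
    rw [Finset.mul_sum]
    refine sum_le_card _ _ _ fun α hα => ?_
    rw [mem_mIdx] at hα
    rw [Finset.mem_range] at hq
    have hw : wt ((Sum.inr (Sum.inl ⟨jk, by simpa using hjk⟩) : Bt d p), α) = q + 2 := by
      simp [wt, bw]; omega
    have := hT (Sum.inr (Sum.inl ⟨jk, by simpa using hjk⟩), α) (by rw [mem_SS]; omega)
    rwa [hw] at this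
  · refine Finset.sum_le_sum fun q hq => ?_
    rw [Finset.mul_sum]
    refine sum_le_card _ _ _ fun α hα => ?_
    rw [mem_mIdx] at hα
    rw [Finset.mem_range] at hq
    have hw : wt ((Sum.inr (Sum.inr ()) : Bt d p), α) = q + 2 := by
      simp [wt, bw]; omega
    have := hT (Sum.inr (Sum.inr ()), α) (by rw [mem_SS]; omega)
    rwa [hw] at this

/-- The concrete weight. -/
def Mw {d p : ℕ} (A : Fin d → Rd d → ℝ) (U : Fin p → Rd d → ℝ) (V : Rd d → ℝ) (r : ℕ)
    (μ : ℝ) : Rd d → ℝ := MM (SS d p r) (ff A U V) wt (r+1).factorial μ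

/-- The concrete normalised coefficients. -/
def pw {d p : ℕ} (A : Fin d → Rd d → ℝ) (U : Fin p → Rd d → ℝ) (V : Rd d → ℝ) (r : ℕ)
    (μ : ℝ) (i : It d p) : Rd d → ℝ := ph (SS d p r) (ff A U V) wt (r+1).factorial μ i

lemma hwt : ∀ i ∈ SS d p r, 1 ≤ wt i ∧ wt i ∣ (r+1).factorial := by
  intro i hi
  rw [mem_SS] at hi
  have : 1 ≤ wt i := by have := bw_pos i.1; unfold wt; omega
  exact ⟨this, Nat.dvd_factorial this hi⟩

lemma hfac (hr : 1 ≤ r) : 2 ≤ (r+1).factorial := by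
  have := Nat.self_le_factorial (r+1); omega

lemma Mw_one (μ : ℝ) (x : Rd d) : 1 ≤ Mw A U V r μ x := MM_one x

lemma ff_le_Mw (hr : 1 ≤ r) {μ : ℝ} (hμ : 1 ≤ μ) {i : It d p} (hi : wt i ≤ r + 1) (x : Rd d) :
    |ff A U V i x| ≤ μ * Mw A U V r μ x ^ (wt i) := by
  have h := f_le (f := ff A U V) (μ := μ) hwt (hfac hr) (mem_SS.2 hi) x
  have hμ0 : 0 < μ := by linarith
  rw [abs_mul, abs_of_pos (inv_pos.2 hμ0), ← div_eq_mul_inv, div_le_iff₀ hμ0] at h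
  unfold Mw
  linarith

include hA hU hV in
lemma ff_deriv (hr : 1 ≤ r) {C₀ : ℝ} (hC₀ : 0 < C₀)
    (hT : ∀ x, mq A U V (r+1) x ≤ C₀ * mr A U V r x) :
    ∃ K : ℝ, 1 ≤ K ∧ ∀ μ : ℝ, 1 ≤ μ → ∀ i : It d p, wt i ≤ r + 1 → ∀ j x,
      |pdR j (ff A U V i) x| ≤ K * μ * Mw A U V r μ x ^ (wt i + 1) := by
  obtain ⟨D, hD, hmr⟩ := mr_le A U V r
  refine ⟨1 + C₀ * (1 + D), by nlinarith [mul_nonneg hC₀.le hD], fun μ hμ i hi j x => ?_⟩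
  have hM1 := Mw_one (A := A) (U := U) (V := V) (r := r) μ x
  set M := Mw A U V r μ x with hM
  have hMp : 0 < M := by linarith
  have hk0 : 0 ≤ C₀ * (1 + D) := by positivity
  have hpp : 0 < μ * M ^ (wt i + 1) := by positivity
  rw [pdR_ff hA hU hV]
  by_cases h : wt i + 1 ≤ r + 1
  · have := ff_le_Mw (A := A) (U := U) (V := V) hr hμ (i := (i.1, i.2 + Pi.single j 1))
      (by rw [wt_succ]; exact h) x
    rw [wt_succ, ← hM] at this
    change _ ≤ μ * M ^ (wt i + 1) at this
    nlinarith [mul_nonneg hk0 hpp.le]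
  · have hw : wt i = r + 1 := by omega
    have h1 := ff_le_mq (A := A) (U := U) (V := V) (q := r) (i.1, i.2 + Pi.single j 1)
      (by rw [wt_succ]; change wt i + 1 = _; omega) x
    have h2 := hT x
    have h3 := hmr x (μ * M ^ (r+1)) (fun i hi => by
      rw [mem_SS] at hi
      refine (ff_le_Mw hr hμ hi x).trans ?_
      rw [← hM]
      have : M ^ wt i ≤ M ^ (r+1) := pow_le_pow_right₀ hM1 hi
      gcongr)
    have h4 : (1:ℝ) ≤ μ * M ^ (r+1) := by
      have := one_le_pow₀ hM1 (n := r+1)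
      nlinarith
    have h5 : μ * M ^ (r+1) ≤ μ * M ^ (wt i + 1) := by
      have : M ^ (r+1) ≤ M ^ (wt i + 1) := pow_le_pow_right₀ hM1 (by omega)
      gcongr
    have h6 : mr A U V r x ≤ (1 + D) * (μ * M ^ (wt i + 1)) := by nlinarith
    have h7 := mul_le_mul_of_nonneg_left h6 hC₀.le
    nlinarith
end

/-! ### Smallness and the conclusion -/

/-- Smallness of a normalised coefficient for large `μ`. -/
def SmallC {d p : ℕ} (A : Fin d → Rd d → ℝ) (U : Fin p → Rd d → ℝ) (V : Rd d → ℝ) (r : ℕ)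
    (i : It d p) : Prop :=
  ∀ η : ℝ, 0 < η → ∃ μ₁ : ℝ, 1 ≤ μ₁ ∧ ∀ μ : ℝ, μ₁ ≤ μ → ∀ u : Rd d → ℂ, SmC u →
    HasCompactSupport u →
    ∫ x, ((pw A U V r μ i x)^2 * (Mw A U V r μ x ^ 4 * ‖u x‖^2))
      ≤ η * EE A U V (Mw A U V r μ) u

section
variable {d p r : ℕ} {A : Fin d → Rd d → ℝ} {U : Fin p → Rd d → ℝ} {V : Rd d → ℝ}
    (hA : ∀ j, SmR (A j)) (hU : ∀ ℓ, SmR (U ℓ)) (hV : SmR V) (hr : 1 ≤ r)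
    {K : ℝ} (hK1 : 1 ≤ K)
    (hK : ∀ μ : ℝ, 1 ≤ μ → ∀ i : It d p, wt i ≤ r + 1 → ∀ j x,
      |pdR j (ff A U V i) x| ≤ K * μ * Mw A U V r μ x ^ (wt i + 1))

include hA hU hV in
lemma Mw_sm (μ : ℝ) : SmR (Mw A U V r μ) := MM_sm (ff_sm hA hU hV)

include hA hU hV hr hK in
lemma Mw_deriv {μ : ℝ} (hμ : 1 ≤ μ) (j : Fin d) (x : Rd d) :
    |pdR j (Mw A U V r μ) x| ≤ ((SS d p r).card * K) * Mw A U V r μ x ^ 2 :=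
  MM_deriv (ff_sm hA hU hV) hwt (hfac hr) hμ
    (fun i hi j x => hK μ hμ i (mem_SS.1 hi) j x) j x

lemma Small_of {i : It d p} {c : ℝ} (hc : 0 ≤ c)
    (h : ∀ μ : ℝ, 1 ≤ μ → ∀ u : Rd d → ℂ, SmC u → HasCompactSupport u →
      ∫ x, ((pw A U V r μ i x)^2 * (Mw A U V r μ x ^ 4 * ‖u x‖^2))
      ≤ (c / μ) * EE A U V (Mw A U V r μ) u) : SmallC A U V r i := by
  intro η hη
  refine ⟨1 + c / η, by have := div_nonneg hc hη.le; linarith, fun μ hμ u hu hcs => ?_⟩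
  have h0 := div_nonneg hc hη.le
  have hμ1 : 1 ≤ μ := by linarith
  refine (h μ hμ1 u hu hcs).trans ?_
  refine mul_le_mul_of_nonneg_right ?_ (EE_nonneg _ _ _ _ _)
  rw [div_le_iff₀ (by linarith)]
  have : c / η ≤ μ := by linarith
  rw [div_le_iff₀ hη] at this
  linarith

lemma ff_zero (b : Bt d p) : ff A U V (b, 0) = bs A U V b := by
  unfold ff
  exact pdMulti_zero _

lemma wt_zero (b : Bt d p) : wt (b, (0 : Fin d → ℕ)) = bw b := by simp [wt]

lemma pw_sq {μ : ℝ} (hμ : 1 ≤ μ) (i : It d p) (x : Rd d) :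
    (pw A U V r μ i x)^2 * (Mw A U V r μ x ^ wt i)^2 = (ff A U V i x)^2 * (μ⁻¹)^2 := by
  have h := ph_mul (S := SS d p r) (f := ff A U V) (w := wt) (N := (r+1).factorial) hμ i x
  unfold pw Mw
  rw [← mul_pow, h, mul_pow]

include hA hU hV hr hK in
lemma Small_base (hK1 : 1 ≤ K) (b : Bt d p) : SmallC A U V r (b, 0) := by
  have hb : wt (b, (0 : Fin d → ℕ)) ≤ r + 1 := by
    rw [wt_zero]; rcases b with l | b <;> simp [bw]; omega
  set K' : ℝ := (SS d p r).card * K with hK'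
  rcases b with l | jk | c
  · refine Small_of (c := 1 + 4 * d * K'^2) (by positivity) fun μ hμ u hu hc => ?_
    have h := energyU hA hU hV (Mw_sm hA hU hV μ) (Mw_one μ)
      (Mw_deriv hA hU hV hr hK hμ) hu hc l
    have e : ∀ x, (pw A U V r μ (Sum.inl l, 0) x)^2 * (Mw A U V r μ x ^ 4 * ‖u x‖^2)
        = (μ⁻¹)^2 * (Mw A U V r μ x ^ 2 * (U l x)^2 * ‖u x‖^2) := by
      intro x
      have h := pw_sq (A := A) (U := U) (V := V) (r := r) hμ (Sum.inl l, 0) x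
      rw [ff_zero, wt_zero] at h
      change _ * (_ ^ 1) ^ 2 = (U l x)^2 * _ at h
      linear_combination (Mw A U V r μ x ^ 2 * ‖u x‖^2) * h
    simp_rw [e]
    rw [integral_const_mul]
    refine (mul_le_mul_of_nonneg_left h (by positivity)).trans ?_
    rw [← mul_assoc]
    refine mul_le_mul_of_nonneg_right ?_ (EE_nonneg _ _ _ _ _)
    rw [div_eq_mul_inv, mul_comm]
    refine mul_le_mul_of_nonneg_left ?_ (by positivity)
    have : μ⁻¹ ≤ 1 := inv_le_one_of_one_le₀ hμ
    have : 0 ≤ μ⁻¹ := by positivity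
    nlinarith
  · refine Small_of (c := K * (4 + 12 * d * K'^2)) (by positivity) fun μ hμ u hu hc => ?_
    have hμ0 : 0 < μ := by linarith
    have g0 := ff_le_Mw (A := A) (U := U) (V := V) hr hμ hb
    have g1 := hK μ hμ _ hb
    rw [ff_zero, wt_zero] at g0 g1
    change ∀ x, |magB A jk.1.1 jk.1.2 x| ≤ μ * Mw A U V r μ x ^ 2 at g0
    change ∀ j x, |pdR j (magB A jk.1.1 jk.1.2) x| ≤ K * μ * Mw A U V r μ x ^ 3 at g1
    have h := energyB hA hU hV (Mw_sm hA hU hV μ) (Mw_one μ)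
      (Mw_deriv hA hU hV hr hK hμ) hu hc (L := K * μ) (by positivity) jk.1.1 jk.1.2
      (fun x => (g0 x).trans (mul_le_mul_of_nonneg_right (by nlinarith) (by positivity))) g1
    have e : ∀ x, (pw A U V r μ (Sum.inr (Sum.inl jk), 0) x)^2 * (Mw A U V r μ x ^ 4 * ‖u x‖^2)
        = (μ⁻¹)^2 * ((magB A jk.1.1 jk.1.2 x)^2 * ‖u x‖^2) := by
      intro x
      have h := pw_sq (A := A) (U := U) (V := V) (r := r) hμ (Sum.inr (Sum.inl jk), 0) x
      rw [ff_zero, wt_zero] at h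
      change _ * (_ ^ 2) ^ 2 = (magB A jk.1.1 jk.1.2 x)^2 * _ at h
      linear_combination (‖u x‖^2) * h
    simp_rw [e]
    rw [integral_const_mul]
    refine (mul_le_mul_of_nonneg_left h (by positivity)).trans ?_
    rw [← mul_assoc]
    refine mul_le_mul_of_nonneg_right (le_of_eq ?_) (EE_nonneg _ _ _ _ _)
    rw [← hK']
    field_simp
  · refine Small_of (c := 1 + K * (1 + 4 * d * K'^2 + d)) (by positivity) fun μ hμ u hu hc => ?_
    have hμ0 : 0 < μ := by linarith
    have g1 := hK μ hμ _ hb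
    rw [ff_zero, wt_zero] at g1
    change ∀ j x, |pdR j V x| ≤ K * μ * Mw A U V r μ x ^ 3 at g1
    have h := energyV hA hU hV (Mw_sm hA hU hV μ) (Mw_one μ)
      (Mw_deriv hA hU hV hr hK hμ) hu hc (L := K * μ) (by positivity) g1
    have e : ∀ x, (pw A U V r μ (Sum.inr (Sum.inr c), 0) x)^2 * (Mw A U V r μ x ^ 4 * ‖u x‖^2)
        = (μ⁻¹)^2 * ((V x)^2 * ‖u x‖^2) := by
      intro x
      have h := pw_sq (A := A) (U := U) (V := V) (r := r) hμ (Sum.inr (Sum.inr c), 0) x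
      rw [ff_zero, wt_zero] at h
      change _ * (_ ^ 2) ^ 2 = (V x)^2 * _ at h
      linear_combination (‖u x‖^2) * h
    simp_rw [e]
    rw [integral_const_mul]
    refine (mul_le_mul_of_nonneg_left h (by positivity)).trans ?_
    rw [← mul_assoc]
    refine mul_le_mul_of_nonneg_right ?_ (EE_nonneg _ _ _ _ _)
    rw [← hK']
    generalize 1 + 4 * (d:ℝ) * K'^2 + d = q
    rw [le_div_iff₀ hμ0]
    have : μ⁻¹ ^ 2 * (1 + K * μ * q) * μ = μ⁻¹ + K * q := by field_simp
    rw [this]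
    have : μ⁻¹ ≤ 1 := inv_le_one_of_one_le₀ hμ
    linarith

include hA hU hV hr hK in
lemma pw_deriv_le {μ : ℝ} (hμ : 1 ≤ μ) (i : It d p) (hi : wt i ≤ r + 1) (j : Fin d) (x : Rd d) :
    |pdR j (pw A U V r μ i) x| ≤ (K + (r+1) * ((SS d p r).card * K)) * Mw A U V r μ x := by
  have hμ0 : 0 < μ := by linarith
  have h1 : 1 ≤ wt i := (hwt i (mem_SS.2 hi)).1
  have hd := ph_deriv (S := SS d p r) (f := ff A U V) (w := wt) (N := (r+1).factorial)
    (ff_sm hA hU hV) hμ h1 j x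
  have hM := Mw_deriv hA hU hV hr hK hμ j x
  have hle := ph_le (S := SS d p r) (f := ff A U V) (w := wt) (N := (r+1).factorial)
    hwt (hfac hr) hμ (mem_SS.2 hi) x
  have hf := hK μ hμ i hi j x
  have hM0 : 0 < Mw A U V r μ x := lt_of_lt_of_le one_pos (Mw_one μ x)
  change pdR j (pw A U V r μ i) x = pdR j (ff A U V i) x / (μ * Mw A U V r μ x ^ (wt i))
      - wt i * pw A U V r μ i x * (pdR j (Mw A U V r μ) x / Mw A U V r μ x) at hd
  change |pw A U V r μ i x| ≤ 1 at hle
  set M := Mw A U V r μ x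
  rw [hd]
  refine (abs_sub _ _).trans ?_
  rw [add_mul]
  refine add_le_add ?_ ?_
  · rw [abs_div, abs_of_pos (by positivity : 0 < μ * M ^ wt i), div_le_iff₀ (by positivity)]
    refine hf.trans (le_of_eq ?_)
    rw [pow_succ]; ring
  · rw [abs_mul, abs_mul, abs_div, abs_of_pos hM0, Nat.abs_cast]
    have e1 : |pdR j (Mw A U V r μ) x| / M ≤ ((SS d p r).card * K) * M := by
      rw [div_le_iff₀ hM0]; nlinarith
    have e0 : 0 ≤ |pdR j (Mw A U V r μ) x| / M := by positivity
    have e2 : (wt i : ℝ) ≤ r + 1 := by exact_mod_cast hi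
    have e3 : (wt i : ℝ) * |pw A U V r μ i x| ≤ (r + 1) * 1 :=
      mul_le_mul e2 hle (abs_nonneg _) (by positivity)
    calc _ ≤ ((r:ℝ) + 1) * 1 * (((SS d p r).card * K) * M) :=
          mul_le_mul e3 e1 e0 (by positivity)
      _ = _ := by ring

include hA hU hV hr hK in
lemma pw_step {μ : ℝ} (hμ : 1 ≤ μ) (b : Bt d p) (α : Fin d → ℕ) (j : Fin d)
    (hi : wt (b, α) ≤ r + 1) (x : Rd d) :
    |Mw A U V r μ x * pw A U V r μ (b, α + Pi.single j 1) x - pdR j (pw A U V r μ (b, α)) x|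
      ≤ ((r+1) * ((SS d p r).card * K)) * Mw A U V r μ x * |pw A U V r μ (b, α) x| := by
  have hμ0 : 0 < μ := by linarith
  have h1 : 1 ≤ wt (b, α) := (hwt (b, α) (mem_SS.2 hi)).1
  have hd := ph_deriv (S := SS d p r) (f := ff A U V) (w := wt) (N := (r+1).factorial)
    (ff_sm hA hU hV) hμ h1 j x
  have hM := Mw_deriv hA hU hV hr hK hμ j x
  have hM0 : 0 < Mw A U V r μ x := lt_of_lt_of_le one_pos (Mw_one μ x)
  rw [pdR_ff hA hU hV] at hd
  change pdR j (pw A U V r μ (b, α)) x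
      = ff A U V (b, α + Pi.single j 1) x / (μ * Mw A U V r μ x ^ (wt (b, α)))
      - wt (b, α) * pw A U V r μ (b, α) x * (pdR j (Mw A U V r μ) x / Mw A U V r μ x) at hd
  have hp : pw A U V r μ (b, α + Pi.single j 1) x
      = ff A U V (b, α + Pi.single j 1) x / (μ * Mw A U V r μ x ^ (wt (b, α) + 1)) := by
    rw [← wt_succ b α j]; rfl
  rw [hd, hp]
  set M := Mw A U V r μ x
  have e : M * (ff A U V (b, α + Pi.single j 1) x / (μ * M ^ (wt (b, α) + 1)))
      - (ff A U V (b, α + Pi.single j 1) x / (μ * M ^ (wt (b, α)))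
      - wt (b, α) * pw A U V r μ (b, α) x * (pdR j (Mw A U V r μ) x / M))
      = wt (b, α) * pw A U V r μ (b, α) x * (pdR j (Mw A U V r μ) x / M) := by
    rw [pow_succ]; field_simp; ring
  rw [e, abs_mul, abs_mul, abs_div, abs_of_pos hM0, Nat.abs_cast]
  have e1 : |pdR j (Mw A U V r μ) x| / M ≤ ((SS d p r).card * K) * M := by
    rw [div_le_iff₀ hM0]; nlinarith
  have e0 : 0 ≤ |pdR j (Mw A U V r μ) x| / M := by positivity
  have e2 : (wt (b, α) : ℝ) ≤ r + 1 := by exact_mod_cast hi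
  calc _ ≤ ((r:ℝ) + 1) * |pw A U V r μ (b, α) x| * (((SS d p r).card * K) * M) :=
        mul_le_mul (mul_le_mul_of_nonneg_right e2 (abs_nonneg _)) e1 e0 (by positivity)
    _ = _ := by ring

include hA hU hV hr hK in
lemma Small_step (hK1 : 1 ≤ K) (b : Bt d p) (α : Fin d → ℕ) (j : Fin d)
    (hi : wt (b, α + Pi.single j 1) ≤ r + 1) (hs : SmallC A U V r (b, α)) :
    SmallC A U V r (b, α + Pi.single j 1) := by
  have hi0 : wt (b, α) ≤ r + 1 := by rw [wt_succ] at hi; omega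
  have hK0 : 0 ≤ K := by linarith
  set K' : ℝ := (SS d p r).card * K with hK'
  have hK'0 : 0 ≤ K' := by positivity
  set L : ℝ := 1 + (K + (r+1) * K') with hL
  have hL0 : 0 ≤ L := by positivity
  set c : ℝ := (L * L + 3 * L + 3 * L * K') * (2 + 4 * d * K'^2) with hcd
  have hc0 : 0 ≤ c := by positivity
  intro η hη
  set s : ℝ := η / (c + 1) with hsd
  have hs0 : 0 < s := by positivity
  obtain ⟨μ₁, h1, h2⟩ := hs (s^2) (by positivity)
  refine ⟨μ₁, h1, fun μ hμ u hu hc => ?_⟩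
  have hμ1 : 1 ≤ μ := h1.trans hμ
  have hM0 : ∀ x, 0 < Mw A U V r μ x := fun x => lt_of_lt_of_le one_pos (Mw_one μ x)
  have h := energyStep hA hU hV (Mw_sm hA hU hV μ) (Mw_one μ)
      (Mw_deriv hA hU hV hr hK hμ1) hu hc hK'0 hs0 hL0 j
      (φ := pw A U V r μ (b, α)) (ψ := pw A U V r μ (b, α + Pi.single j 1))
      (ph_sm (ff_sm hA hU hV) hμ1 _) (ph_sm (ff_sm hA hU hV) hμ1 _)
      (fun x => (ph_le (f := ff A U V) hwt (hfac hr) hμ1 (mem_SS.2 hi) x).trans (by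
        rw [hL]; have : 0 ≤ K + (r+1) * K' := by positivity
        linarith))
      (fun x => (pw_deriv_le hA hU hV hr hK hμ1 _ hi j x).trans
        (mul_le_mul_of_nonneg_right (by rw [hL]; linarith) (hM0 x).le))
      (fun x => (pw_step hA hU hV hr hK hμ1 b α j hi0 x).trans
        (mul_le_mul_of_nonneg_right
          (mul_le_mul_of_nonneg_right (by rw [hL]; linarith) (hM0 x).le) (abs_nonneg _)))
      (h2 μ hμ u hu hc)
  refine h.trans (mul_le_mul_of_nonneg_right ?_ (EE_nonneg _ _ _ _ _))
  change s * c ≤ η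
  rw [hsd, div_mul_eq_mul_div, div_le_iff₀ (by positivity)]
  nlinarith

include hA hU hV hr hK in
lemma Small_all (hK1 : 1 ≤ K) (b : Bt d p) : ∀ (n : ℕ) (α : Fin d → ℕ), ∑ j, α j = n →
    wt (b, α) ≤ r + 1 → SmallC A U V r (b, α) := by
  intro n
  induction n with
  | zero =>
    intro α hα _
    have : α = 0 := by
      funext j
      exact (Finset.sum_eq_zero_iff.1 hα) j (Finset.mem_univ j)
    rw [this]
    exact Small_base hA hU hV hr hK hK1 b
  | succ n ih =>
    intro α hα hw
    obtain ⟨j, hj⟩ : ∃ j, α j ≠ 0 := by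
      by_contra h
      push Not at h
      simp [h] at hα
    have e : α = (α - Pi.single j 1) + Pi.single j 1 := by
      funext k
      by_cases hk : k = j
      · subst hk; simp; omega
      · simp [hk]
    rw [e] at hw hα ⊢
    have hw' := hw
    rw [wt_succ] at hw'
    refine Small_step hA hU hV hr hK hK1 b _ j hw (ih _ ?_ (by omega))
    simp only [Pi.add_apply, Finset.sum_add_distrib] at hα
    rw [Finset.sum_pi_single'] at hα
    simpa using hα

include hA hU hV hr hK in
lemma Small_unif (hK1 : 1 ≤ K) {η : ℝ} (hη : 0 < η) (S : Finset (It d p)) :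
    S ⊆ SS d p r → ∃ μ₁ : ℝ, 1 ≤ μ₁ ∧ ∀ i ∈ S, ∀ μ : ℝ, μ₁ ≤ μ → ∀ u : Rd d → ℂ, SmC u →
    HasCompactSupport u →
    ∫ x, ((pw A U V r μ i x)^2 * (Mw A U V r μ x ^ 4 * ‖u x‖^2))
      ≤ η * EE A U V (Mw A U V r μ) u := by
  classical
  induction S using Finset.induction_on with
  | empty => intro _; exact ⟨1, le_rfl, by simp⟩
  | insert i S hi ih =>
    intro hS
    obtain ⟨m1, h1, h2⟩ := ih (fun k hk => hS (Finset.mem_insert_of_mem hk))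
    obtain ⟨m2, h3, h4⟩ := Small_all hA hU hV hr hK hK1 i.1 _ i.2 rfl
      (mem_SS.1 (hS (Finset.mem_insert_self i S))) η hη
    refine ⟨max m1 m2, h1.trans (le_max_left _ _), fun k hk μ hμ u hu hc => ?_⟩
    rcases Finset.mem_insert.1 hk with rfl | hk
    · exact h4 μ ((le_max_right _ _).trans hμ) u hu hc
    · exact h2 k hk μ ((le_max_left _ _).trans hμ) u hu hc

include hA hU hV hr hK in
/-- The main weighted estimate with the smooth weight. -/
lemma main_weight (hK1 : 1 ≤ K) : ∃ μ₁ : ℝ, 1 < μ₁ ∧ ∃ C : ℝ, 0 < C ∧ ∀ u : Rd d → ℂ, SmC u →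
    HasCompactSupport u →
    ∫ x, (Mw A U V r μ₁ x ^ 4 * ‖u x‖^2 + Mw A U V r μ₁ x ^ 2 * ∑ j, ‖Xop A j u x‖^2)
      ≤ C * (∫ x, ‖u x‖^2) + C * ∫ x, ‖Pop A U V u x‖^2 := by
  set n : ℝ := ((SS d p r).card : ℝ) with hn
  have hn0 : 0 ≤ n := by positivity
  obtain ⟨m, hm1, hm⟩ := Small_unif hA hU hV hr hK hK1 (η := 1 / (2 * (n + 1))) (by positivity)
    (SS d p r) (Finset.Subset.refl _)
  have hμ1 : 1 ≤ m + 1 := by linarith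
  have hQc : (0:ℝ) ≤ 1 + 4 * d * (n * K)^2 := by positivity
  set q : ℝ := 1 + 4 * d * (n * K)^2 with hq
  refine ⟨m + 1, by linarith, 2 + 2 * q, by positivity, fun u hu hc => ?_⟩
  have hMs : SmR (Mw A U V r (m+1)) := Mw_sm hA hU hV (m+1)
  have hEQ := energyQ hA hU hV hMs (Mw_one (m+1))
      (Mw_deriv hA hU hV hr hK hμ1) hu hc
  have c4 := CC_M4 hMs hu hc
  have cu := CC_normsq hu hc
  have cQ : CC (fun x => Mw A U V r (m+1) x ^ 2 * ∑ j, ‖Xop A j u x‖^2) :=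
    CC.mulL (hMs.continuous.pow 2) (CC_Q hA hu hc)
  have cS : ∀ i, CC (fun x => (pw A U V r (m+1) i x)^2 * (Mw A U V r (m+1) x ^ 4 * ‖u x‖^2)) :=
    fun i => CC.mulL ((ph_sm (ff_sm hA hU hV) hμ1 i).continuous.pow 2) c4
  rw [integral_add c4.int cQ.int]
  have hI : ∫ x, Mw A U V r (m+1) x ^ 4 * ‖u x‖^2 ≤ (∫ x, ‖u x‖^2)
      + ∑ i ∈ SS d p r,
        ∫ x, (pw A U V r (m+1) i x)^2 * (Mw A U V r (m+1) x ^ 4 * ‖u x‖^2) := by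
    rw [← integral_finsetSum _ fun i _ => (cS i).int,
      ← integral_add cu.int (integrable_finsetSum _ fun i _ => (cS i).int)]
    refine integral_mono c4.int
      (cu.int.add (integrable_finsetSum _ fun i _ => (cS i).int)) fun x => ?_
    have h := M4_le (S := SS d p r) (f := ff A U V) (w := wt) (N := (r+1).factorial)
      hwt (hfac hr) hμ1 x
    change Mw A U V r (m+1) x ^ 4
      ≤ 1 + ∑ i ∈ SS d p r, (pw A U V r (m+1) i x)^2 * Mw A U V r (m+1) x ^ 4 at h
    have h' := mul_le_mul_of_nonneg_right h (by positivity : 0 ≤ ‖u x‖^2)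
    rw [add_mul, one_mul, Finset.sum_mul] at h'
    simpa only [mul_assoc] using h'
  have hS := sum_le_card (SS d p r) _ _ (fun i hi => hm i hi (m+1) (by linarith) u hu hc)
  have hE0 := EE_nonneg A U V (Mw A U V r (m+1)) u
  have hEdef : EE A U V (Mw A U V r (m+1)) u = (∫ x, ‖Pop A U V u x‖^2)
    + ∫ x, Mw A U V r (m+1) x ^ 4 * ‖u x‖^2 := rfl
  have hhalf : n * (1 / (2 * (n + 1)) * EE A U V (Mw A U V r (m+1)) u)
      ≤ 1/2 * EE A U V (Mw A U V r (m+1)) u := by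
    rw [← mul_assoc]
    refine mul_le_mul_of_nonneg_right ?_ hE0
    rw [mul_one_div, div_le_iff₀ (by positivity)]
    linarith
  have p0 : 0 ≤ ∫ x, ‖Pop A U V u x‖^2 := integral_nonneg fun x => by positivity
  have u0 : 0 ≤ ∫ x, ‖u x‖^2 := integral_nonneg fun x => by positivity
  set I4 := ∫ x, Mw A U V r (m+1) x ^ 4 * ‖u x‖^2
  set IP := ∫ x, ‖Pop A U V u x‖^2
  set Iu := ∫ x, ‖u x‖^2
  have hI4 : I4 ≤ 2 * Iu + IP := by
    rw [← hn] at hS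
    rw [hEdef] at hhalf hS
    linarith
  have hEle : EE A U V (Mw A U V r (m+1)) u ≤ 2 * Iu + 2 * IP := by rw [hEdef]; linarith
  have := hEQ.trans (mul_le_mul_of_nonneg_left hEle hQc)
  nlinarith

include hr in
lemma Rfun_ge {μ₁ : ℝ} (hμ₁ : 1 ≤ μ₁) : ∃ c : ℝ, 0 < c ∧ c ≤ 1 ∧ ∀ μ : ℝ, μ₁ ≤ μ → ∀ x,
    c / Mw A U V r μ₁ x ≤ Rfun A U V r x μ := by
  obtain ⟨D, hD, hPhi⟩ := Phi_le A U V r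
  refine ⟨1 / (D + 1), by positivity, ?_, fun μ hμ x => ?_⟩
  · rw [div_le_one (by positivity)]; linarith
  have hM1 := Mw_one (A := A) (U := U) (V := V) (r := r) μ₁ x
  set M := Mw A U V r μ₁ x with hM
  have hM0 : 0 < M := by linarith
  set c : ℝ := 1 / (D + 1) with hc
  have hc0 : 0 < c := by positivity
  have hc1 : c ≤ 1 := by rw [hc, div_le_one (by positivity)]; linarith
  have hDc : D * c ≤ 1 := by rw [hc, mul_one_div, div_le_one (by positivity)]; linarith
  unfold Rfun
  refine le_csSup ⟨1, fun t ht => ht.1.2⟩ ⟨⟨by positivity, ?_⟩, ?_⟩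
  · rw [div_le_one hM0]; linarith
  · refine (hPhi x (c / M) (c * μ₁) (by positivity) fun i hi => ?_).trans ?_
    · have h := ff_le_Mw (A := A) (U := U) (V := V) hr hμ₁ (mem_SS.1 hi) x
      rw [← hM] at h
      rw [div_pow]
      have hw := (hwt i hi).1
      have hcw : c ^ wt i ≤ c := by
        calc c ^ wt i ≤ c ^ 1 := pow_le_pow_of_le_one hc0.le hc1 hw
          _ = c := pow_one c
      rw [div_mul_eq_mul_div, div_le_iff₀ (by positivity)]
      calc c ^ wt i * |ff A U V i x| ≤ c * (μ₁ * M ^ wt i) :=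
            mul_le_mul hcw h (abs_nonneg _) hc0.le
        _ = _ := by ring
    · nlinarith

end

/-- global weighted estimate. -/
theorem statement_19 (d p r : ℕ) (hd : 1 ≤ d) (hr : 1 ≤ r)
    (A : Fin d → Rd d → ℝ) (U : Fin p → Rd d → ℝ) (V : Rd d → ℝ)
    (hA : ∀ j, ContDiff ℝ (⊤ : ℕ∞) (A j)) (hU : ∀ ℓ, ContDiff ℝ (⊤ : ℕ∞) (U ℓ)) (hV : ContDiff ℝ (⊤ : ℕ∞) V)
    (C₀ : ℝ) (hC₀ : 0 < C₀)
    (hT : ∀ x, mq A U V (r+1) x ≤ C₀ * mr A U V r x) :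
    ∃ δ > (0:ℝ), ∃ μ₀ > (1:ℝ), ∃ C > (0:ℝ),
      ∀ μ : ℝ, μ₀ ≤ μ → ∀ u : Rd d → ℂ, ContDiff ℝ (⊤ : ℕ∞) u → HasCompactSupport u →
        (∫ x : Rd d, (‖u x‖^2 / (Rfun A U V r x μ)^4
            + (∑ j, ‖Xop A j u x‖^2) / (Rfun A U V r x μ)^2))
          ≤ C * (∫ x : Rd d, ‖u x‖^2)
            + C * (1 + μ ^ (-(2*δ))) * ∫ x : Rd d, ‖Pop A U V u x‖^2 := by
  obtain ⟨K, hK1, hK⟩ := ff_deriv hA hU hV hr hC₀ hT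
  obtain ⟨μ₁, hμ₁, C, hC, hmain⟩ := main_weight hA hU hV hr hK hK1
  obtain ⟨c, hc0, hc1, hR⟩ := Rfun_ge (A := A) (U := U) (V := V) hr hμ₁.le
  refine ⟨1, one_pos, μ₁, hμ₁, C / c^4, by positivity, fun μ hμ u hu hcs => ?_⟩
  have hMs : SmR (Mw A U V r μ₁) := Mw_sm hA hU hV μ₁
  have c4 := CC_M4 hMs hu hcs
  have cQ : CC (fun x => Mw A U V r μ₁ x ^ 2 * ∑ j, ‖Xop A j u x‖^2) :=
    CC.mulL (hMs.continuous.pow 2) (CC_Q hA hu hcs)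
  have hle : ∫ x, (‖u x‖^2 / (Rfun A U V r x μ)^4
            + (∑ j, ‖Xop A j u x‖^2) / (Rfun A U V r x μ)^2)
      ≤ ∫ x, (1 / c^4) * (Mw A U V r μ₁ x ^ 4 * ‖u x‖^2
          + Mw A U V r μ₁ x ^ 2 * ∑ j, ‖Xop A j u x‖^2) := by
    refine integral_mono_of_nonneg (ae_of_all _ fun x => ?_)
      (((c4.int.add cQ.int)).const_mul _) (ae_of_all _ fun x => ?_)
    · have h1 : 0 ≤ ∑ j, ‖Xop A j u x‖^2 := Finset.sum_nonneg fun _ _ => by positivity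
      change 0 ≤ ‖u x‖^2 / (Rfun A U V r x μ)^4
            + (∑ j, ‖Xop A j u x‖^2) / (Rfun A U V r x μ)^2
      positivity
    · have h1 : 0 ≤ ∑ j, ‖Xop A j u x‖^2 := Finset.sum_nonneg fun _ _ => by positivity
      have hM0 : 0 < Mw A U V r μ₁ x := lt_of_lt_of_le one_pos (Mw_one μ₁ x)
      have hRx := hR μ hμ x
      change ‖u x‖^2 / (Rfun A U V r x μ)^4
            + (∑ j, ‖Xop A j u x‖^2) / (Rfun A U V r x μ)^2
          ≤ (1 / c^4) * (Mw A U V r μ₁ x ^ 4 * ‖u x‖^2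
          + Mw A U V r μ₁ x ^ 2 * ∑ j, ‖Xop A j u x‖^2)
      have hq : 0 < c / Mw A U V r μ₁ x := by positivity
      have e4 : ‖u x‖^2 / (Rfun A U V r x μ)^4 ≤ ‖u x‖^2 / (c / Mw A U V r μ₁ x)^4 := by
        gcongr
      have e2 : (∑ j, ‖Xop A j u x‖^2) / (Rfun A U V r x μ)^2
          ≤ (∑ j, ‖Xop A j u x‖^2) / (c / Mw A U V r μ₁ x)^2 := by
        gcongr
      have f4 : ‖u x‖^2 / (c / Mw A U V r μ₁ x)^4
          = (1 / c^4) * (Mw A U V r μ₁ x ^ 4 * ‖u x‖^2) := by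
        field_simp
      have f2 : (∑ j, ‖Xop A j u x‖^2) / (c / Mw A U V r μ₁ x)^2
          = (1 / c^2) * (Mw A U V r μ₁ x ^ 2 * ∑ j, ‖Xop A j u x‖^2) := by
        field_simp
      have g2 : (1 / c^2) * (Mw A U V r μ₁ x ^ 2 * ∑ j, ‖Xop A j u x‖^2)
          ≤ (1 / c^4) * (Mw A U V r μ₁ x ^ 2 * ∑ j, ‖Xop A j u x‖^2) := by
        refine mul_le_mul_of_nonneg_right ?_ (by positivity)
        exact one_div_le_one_div_of_le (by positivity)
          (pow_le_pow_of_le_one hc0.le hc1 (by norm_num))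
      rw [mul_add]
      linarith
  refine hle.trans ?_
  rw [integral_const_mul]
  have hm := mul_le_mul_of_nonneg_left (hmain u hu hcs) (by positivity : 0 ≤ 1 / c^4)
  refine hm.trans ?_
  have p0 : 0 ≤ ∫ x, ‖Pop A U V u x‖^2 := integral_nonneg fun x => by positivity
  have hμp : 0 ≤ μ ^ (-(2 * (1:ℝ))) := Real.rpow_nonneg (by linarith) _
  have hCc : 0 ≤ C / c^4 := by positivity
  have e : 1 / c^4 * (C * (∫ x, ‖u x‖^2) + C * ∫ x, ‖Pop A U V u x‖^2)
      = C / c^4 * (∫ x, ‖u x‖^2) + C / c^4 * ∫ x, ‖Pop A U V u x‖^2 := by ring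
  rw [e]
  have := mul_nonneg (mul_nonneg hCc hμp) p0
  nlinarith

end
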